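/- Let F_q be a finite field with q elements. For every ε > 0 there exists δ > 0 such that for all sufficiently large q, all λ ∈ F_q*, and all sets A, B, C, D ⊆ F_q with |A| ≥ q^{1/2+ε}, |B| ≥ q^ε, and |C||D| ≥ q^{2-δ}, the number N(A,B,C,D;λ) of solutions of ab + cd = λ with (a,b,c,d) ∈ A×B×C×D satisfies N(A,B,C,D;λ) = (|A||B||C||D|/q)·(1 + O(q^{-δ})). -/

import Mathlib

open Finset

namespace KWeil
open Polynomial

/-- numeric inequality used in the pigeonhole step of the Stepanov method -/
lemma stepanov_count (n L d M : ℕ) (hn : 0 < n) (hL : 0 < L) (hM : M = n * (L + d) + 1)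
    (hlarge : 2 * (2 + d * n) ≤ M) :
    M * (L - 1) + (L + 4 * d + 4) + d * ((L + d) * (n - 1)) < n * (L + 4 * d + 4) * L := by
  obtain ⟨l, rfl⟩ : ∃ l, L = l + 1 := ⟨L - 1, by omega⟩
  obtain ⟨m, rfl⟩ : ∃ m, n = m + 1 := ⟨n - 1, by omega⟩
  simp only [Nat.add_sub_cancel]
  have h1 : (l + 1 + d) * m + (l + 1 + d) + 1 = M := by rw [hM]; ring
  have h2 : d * ((l + 1 + d) * m) ≤ d * M := Nat.mul_le_mul_left _ (by omega)
  have h3 : (4 * d + 4) * (2 * (2 + d * (m + 1))) ≤ (4 * d + 4) * M :=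
    Nat.mul_le_mul_left _ hlarge
  have h4 : (m + 1) * (l + 1) ≤ M := by rw [hM]; nlinarith
  have h5 : d * ((m + 1) * (l + 1)) ≤ d * M := Nat.mul_le_mul_left _ h4
  have h6 : l + 1 ≤ M := by nlinarith
  have h7 : 0 < M := by omega
  zify at *
  have e1 : ((m : ℤ) + 1) * (l + 1) = M - 1 - (m + 1) * d := by rw [hM]; ring
  have e2 : ((m : ℤ) + 1) * (l + 1 + 4 * d + 4) * (l + 1)
      = (l + 1 + 4 * d + 4) * (M - 1 - (m + 1) * d) := by rw [← e1]; ring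
  rw [e2]
  nlinarith

lemma stepanov_inj (n L d M a b a' b' σ σ' e : ℕ) (hM : n * e + 1 = M) (he : e = L + d)
    (hL : 0 < L)
    (hcop : d.Coprime n) (hb : b < n) (hb' : b' < n) (hσ : σ < L) (hσ' : σ' < L)
    (h : σ + a * M + e * b * d = σ' + a' * M + e * b' * d) : a = a' ∧ b = b' := by
  have key : ∀ a b a' b' σ σ' : ℕ, b < n → b' < n → σ < L → σ' < L →
      σ + a * M + e * b * d = σ' + a' * M + e * b' * d →
      n * a + d * b ≤ n * a' + d * b' := by
    intro a b a' b' σ σ' hb hb' hσ hσ' h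
    by_contra hlt
    push Not at hlt
    have h1 : n * σ + M * (n * a + d * b) + d * b' = n * σ' + M * (n * a' + d * b') + d * b := by
      zify at *
      have : (n : ℤ) * e = M - 1 := by linarith
      have h3 : (n : ℤ) * (σ + a * M + e * b * d) = n * (σ' + a' * M + e * b' * d) := by rw [h]
      have h4 : (n : ℤ) * σ + n * a * M + (n * e) * b * d
        = n * σ' + n * a' * M + (n * e) * b' * d := by linear_combination h3
      rw [this] at h4
      linear_combination h4
    have h2 : M * (n * a' + d * b' + 1) ≤ M * (n * a + d * b) := Nat.mul_le_mul_left _ hlt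
    have h3 : n * (σ' + 1) ≤ n * L := Nat.mul_le_mul_left _ hσ'
    have h4 : d * (b + 1) ≤ d * n := Nat.mul_le_mul_left _ hb
    have h5 : n * e = n * L + d * n := by rw [he]; ring
    nlinarith
  have h0 := le_antisymm (key a b a' b' σ σ' hb hb' hσ hσ' h)
    (key a' b' a b σ' σ hb' hb hσ' hσ h.symm)
  have hbb : b = b' := by
    have hm : d * b ≡ d * b' [MOD n] := by
      have := congrArg (· % n) h0
      simpa [Nat.ModEq, Nat.add_mod, Nat.mul_mod_right] using this
    have := Nat.ModEq.cancel_left_of_coprime (by simpa [Nat.coprime_comm] using hcop) hm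
    exact Nat.ModEq.eq_of_lt_of_lt this hb hb'
  subst hbb
  refine ⟨?_, rfl⟩
  have : n * a = n * a' := by omega
  exact Nat.eq_of_mul_eq_mul_left (by omega) this

section
variable {E : Type*} [Field E]

/-- polynomial with given coefficients -/
noncomputable def spol {L : ℕ} (v : Fin L → E) : E[X] := ∑ k : Fin L, C (v k) * X ^ (k : ℕ)

lemma spol_coeff {L : ℕ} (v : Fin L → E) (k : Fin L) : (spol v).coeff k = v k := by
  unfold spol
  simp [Polynomial.finset_sum_coeff, coeff_X_pow, Fin.val_inj]

lemma spol_natDegree {L : ℕ} (hL : 0 < L) (v : Fin L → E) : (spol v).natDegree ≤ L - 1 := by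
  unfold spol
  refine natDegree_sum_le_of_forall_le _ _ fun k _ => ?_
  refine (natDegree_C_mul_X_pow_le _ _).trans (by omega)

lemma spol_sub {L : ℕ} (v w : Fin L → E) : spol (v - w) = spol v - spol w := by
  unfold spol
  simp [sub_mul, Finset.sum_sub_distrib]

variable [Fintype E] [DecidableEq E]

theorem stepanov (p : ℕ) [Fact p.Prime] [CharP E p] (s M n e d : ℕ) (hMp : M = p ^ s)
    (hQ : Fintype.card E = M ^ 2) (hn : 0 < n) (hM : n * e + 1 = M)
    (f : E[X]) (hf : f.Monic) (hd : f.natDegree = d) (hcop : d.Coprime n)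
    (hlarge : 2 * (2 + d * n) ≤ M) (ζ : E) (hζ : ζ ≠ 0) :
    (univ.filter fun x : E => f.eval x ^ (e * (M + 1)) = ζ).card ≤ (e + 4 * d + 5) * M := by
  have hed : d < e := by
    by_contra h
    push Not at h
    have : n * e ≤ n * d := Nat.mul_le_mul_left _ h
    nlinarith
  obtain ⟨L, he⟩ : ∃ L, e = L + d := ⟨e - d, by omega⟩
  have hL : 0 < L := by omega
  set J := L + 4 * d + 4 with hJ
  set K := M * (L - 1) + J + d * (e * (n - 1)) with hK
  have hcount : K < n * J * L := by
    have := stepanov_count n L d M hn hL (by rw [← he]; omega) hlarge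
    rw [hK, he]; exact this
  -- the condition polynomial
  let V := Fin J × Fin n → Fin L → E
  let Cnd : V → E[X] := fun v =>
    ∑ i : Fin J × Fin n, spol (v i) ^ M * X ^ (i.1 : ℕ) * f ^ (e * (n - 1 - (i.2 : ℕ)))
  have hCsub : ∀ v w : V, Cnd (v - w) = Cnd v - Cnd w := by
    intro v w
    simp only [Cnd, ← Finset.sum_sub_distrib]
    refine Finset.sum_congr rfl fun i _ => ?_
    have : spol ((v - w) i) ^ M = spol (v i) ^ M - spol (w i) ^ M := by
      rw [Pi.sub_apply, spol_sub, hMp, ← iterateFrobenius_def, ← iterateFrobenius_def,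
        ← iterateFrobenius_def, map_sub]
    rw [this]; ring
  have hCdeg : ∀ v : V, (Cnd v).natDegree < K := by
    intro v
    have : (Cnd v).natDegree ≤ M * (L - 1) + (J - 1) + d * (e * (n - 1)) := by
      refine natDegree_sum_le_of_forall_le _ _ fun i _ => ?_
      refine natDegree_mul_le_of_le (natDegree_mul_le_of_le
        (natDegree_pow_le_of_le M (spol_natDegree hL _)) ((natDegree_X_pow _).le.trans (by omega))) ?_
      refine natDegree_pow_le.trans ?_
      rw [hd, mul_comm d]
      refine Nat.mul_le_mul_right _ (Nat.mul_le_mul_left _ (by omega))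
    omega
  obtain ⟨v, hv0, hv⟩ : ∃ v : V, v ≠ 0 ∧ Cnd v = 0 := by
    have hcard : Fintype.card (Fin K → E) < Fintype.card V := by
      simp only [V, Fintype.card_fun, Fintype.card_prod, Fintype.card_fin]
      rw [← pow_mul]
      refine Nat.pow_lt_pow_right Fintype.one_lt_card ?_
      calc K < n * J * L := hcount
        _ = L * (J * n) := by ring
    obtain ⟨v, w, hvw, h⟩ := Fintype.exists_ne_map_eq_of_card_lt
      (fun v : V => fun t : Fin K => (Cnd v).coeff t) hcard
    refine ⟨v - w, sub_ne_zero.2 hvw, ?_⟩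
    rw [hCsub, sub_eq_zero]
    ext t
    by_cases ht : t < K
    · exact congrFun h ⟨t, ht⟩
    · rw [coeff_eq_zero_of_natDegree_lt (lt_of_lt_of_le (hCdeg v) (by omega)),
        coeff_eq_zero_of_natDegree_lt (lt_of_lt_of_le (hCdeg w) (by omega))]
  set w : E := (ζ⁻¹) ^ M with hw
  have hwM : w ^ M = ζ⁻¹ := by
    rw [hw, ← pow_mul, ← sq, ← hQ, FiniteField.pow_card]
  have hw0 : w ≠ 0 := pow_ne_zero _ (inv_ne_zero hζ)
  have hf0 : f ≠ 0 := hf.ne_zero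
  let g : Fin J × Fin n → E[X] := fun i =>
    C (w ^ (i.2 : ℕ)) * (spol (v i) * X ^ ((i.1 : ℕ) * M) * f ^ (e * (i.2 : ℕ)))
  let G : E[X] := ∑ i, g i
  have hgdeg : ∀ i, spol (v i) ≠ 0 →
      (g i).natDegree = (spol (v i)).natDegree + i.1 * M + e * i.2 * d := by
    intro i hi
    simp only [g]
    rw [natDegree_C_mul (pow_ne_zero _ hw0), natDegree_mul (mul_ne_zero hi (pow_ne_zero _ X_ne_zero))
      (pow_ne_zero _ hf0), natDegree_mul hi (pow_ne_zero _ X_ne_zero), natDegree_X_pow,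
      natDegree_pow, hd]
  have hg0 : ∀ i, g i ≠ 0 → spol (v i) ≠ 0 := by
    intro i hi h
    apply hi
    simp [g, h]
  have hG0 : G ≠ 0 := by
    have hdeg := degree_sum_eq_of_disjoint g univ (by
      rintro i ⟨_, hi⟩ j ⟨_, hj⟩ hij
      simp only [Function.onFun, Function.comp]
      rw [degree_eq_natDegree hi, degree_eq_natDegree hj]
      intro h
      have h' : (g i).natDegree = (g j).natDegree := by exact_mod_cast h
      rw [hgdeg i (hg0 i hi), hgdeg j (hg0 j hj)] at h'
      have := stepanov_inj n L d M i.1 i.2 j.1 j.2 _ _ e hM he hL hcop i.2.2 j.2.2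
        (lt_of_le_of_lt (spol_natDegree hL _) (by omega))
        (lt_of_le_of_lt (spol_natDegree hL _) (by omega)) h'
      exact hij (Prod.ext (Fin.ext this.1) (Fin.ext this.2)))
    obtain ⟨i, hi⟩ : ∃ i, v i ≠ 0 := by
      by_contra h; push Not at h; exact hv0 (funext h)
    have hsi : spol (v i) ≠ 0 := by
      intro h
      apply hi
      funext k
      rw [← spol_coeff (v i) k, h]; simp
    have hgi : g i ≠ 0 := by
      simp only [g]
      exact mul_ne_zero (C_ne_zero.2 (pow_ne_zero _ hw0))
        (mul_ne_zero (mul_ne_zero hsi (pow_ne_zero _ X_ne_zero)) (pow_ne_zero _ hf0))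
    intro hG
    have h1 : degree (g i) ≤ univ.sup fun i => degree (g i) :=
      Finset.le_sup (f := fun i => degree (g i)) (mem_univ i)
    rw [← hdeg] at h1
    change degree (g i) ≤ degree G at h1
    rw [hG, degree_zero, le_bot_iff, degree_eq_bot] at h1
    exact hgi h1
  have hGdeg : G.natDegree ≤ (e + 4 * d + 5) * M := by
    have h1 : G.natDegree ≤ (L - 1) + (J - 1) * M + e * (n - 1) * d := by
      refine natDegree_sum_le_of_forall_le _ _ fun i _ => ?_
      by_cases hi : spol (v i) = 0
      · simp [g, hi]
      · rw [hgdeg i hi]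
        have := spol_natDegree hL (v i)
        have h1 : (i.1 : ℕ) * M ≤ (J - 1) * M := Nat.mul_le_mul_right _ (by omega)
        have h2 : e * (i.2 : ℕ) * d ≤ e * (n - 1) * d :=
          Nat.mul_le_mul_right _ (Nat.mul_le_mul_left _ (by omega))
        omega
    have h2 : e * (n - 1) ≤ M := by
      have : e * (n - 1) ≤ e * n := Nat.mul_le_mul_left _ (by omega)
      nlinarith
    have h3 : e * (n - 1) * d ≤ M * d := Nat.mul_le_mul_right _ h2
    have h4 : (J - 1) * M = (L + 4 * d + 3) * M := by rw [hJ]; congr 1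
    have h5 : L ≤ M := by nlinarith
    have h6 : (e + 4 * d + 5) * M = (L + 4 * d + 3) * M + M * d + 2 * M := by rw [he]; ring
    omega
  refine le_trans ?_ hGdeg
  refine le_trans ?_ (card_roots' G)
  refine le_trans ?_ (Multiset.toFinset_card_le _)
  refine Finset.card_le_card fun x hx => ?_
  rw [mem_filter] at hx
  rw [Multiset.mem_toFinset, mem_roots hG0, IsRoot.def]
  have hfx : f.eval x ≠ 0 := by
    intro h
    apply hζ
    rw [← hx.2, h, zero_pow]
    have : 0 < e := by omega
    positivity
  have hxQ : x ^ (M * M) = x := by rw [← sq, ← hQ, FiniteField.pow_card]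
  have hGM : (G.eval x) ^ M * f.eval x ^ (e * (n - 1)) = (Cnd v).eval x := by
    simp only [G, Cnd, eval_finset_sum]
    rw [hMp, ← iterateFrobenius_def, map_sum, Finset.sum_mul]
    refine Finset.sum_congr rfl fun i _ => ?_
    rw [iterateFrobenius_def, ← hMp]
    simp only [g, eval_mul, eval_pow, eval_C, eval_X]
    have hb : (i.2 : ℕ) ≤ n - 1 := by omega
    obtain ⟨b', hb'⟩ := Nat.exists_eq_add_of_le hb
    rw [hb', Nat.add_sub_cancel_left]
    simp only [mul_pow]
    have e1 : (w ^ (i.2 : ℕ)) ^ M = (ζ⁻¹) ^ (i.2 : ℕ) := by rw [← pow_mul, mul_comm, pow_mul, hwM]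
    have e2 : (x ^ ((i.1 : ℕ) * M)) ^ M = x ^ (i.1 : ℕ) := by
      rw [← pow_mul, mul_assoc, mul_comm, pow_mul, hxQ]
    have e3 : (eval x f ^ (e * (i.2 : ℕ))) ^ M * eval x f ^ (e * ((i.2 : ℕ) + b'))
        = ζ ^ (i.2 : ℕ) * eval x f ^ (e * b') := by
      rw [← hx.2]; ring
    calc _ = (ζ⁻¹) ^ (i.2 : ℕ) * (eval x (spol (v i)) ^ M * x ^ (i.1 : ℕ)) *
          ((eval x f ^ (e * (i.2 : ℕ))) ^ M * eval x f ^ (e * ((i.2 : ℕ) + b'))) := by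
            rw [e1, e2]; ring
      _ = _ := by
        rw [e3, inv_pow]
        have : ζ ^ (i.2 : ℕ) ≠ 0 := pow_ne_zero _ hζ
        field_simp
  rw [hv, eval_zero, mul_eq_zero] at hGM
  rcases hGM with h | h
  · exact eq_zero_of_pow_eq_zero h
  · exact absurd (eq_zero_of_pow_eq_zero h) hfx

end

section
variable {E : Type*} [Field E] [Fintype E] [DecidableEq E]

lemma norm_mulChar_le (χ : MulChar E ℂ) (a : E) : ‖χ a‖ ≤ 1 := by
  by_cases ha : IsUnit a
  · exact (Complex.norm_eq_one_of_mem_rootsOfUnity (χ.apply_mem_rootsOfUnity ha.unit)).le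
  · rw [χ.map_nonunit ha]; simp

lemma norm_mulChar_eq (χ : MulChar E ℂ) (a : E) (ha : a ≠ 0) : ‖χ a‖ = 1 :=
  Complex.norm_eq_one_of_mem_rootsOfUnity (χ.apply_mem_rootsOfUnity (Units.mk0 a ha))

lemma card_fibre (n m : ℕ) (hn : 0 < n) (hm : 0 < m) (h : Fintype.card E = n * m + 1) (z : Eˣ) :
    (univ.filter fun y : Eˣ => z ^ m = y ^ m).card = m := by
  have hc : Nat.card Eˣ = n * m := by
    rw [Nat.card_eq_fintype_card, Fintype.card_units, h]; simp
  have h1 := IsCyclic.card_powMonoidHom_ker (G := Eˣ) m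
  rw [hc, Nat.gcd_eq_right (Dvd.intro_left _ rfl)] at h1
  have h2 : (univ.filter fun u : Eˣ => u ^ m = 1).card = m := by
    rw [← Fintype.card_subtype, ← Nat.card_eq_fintype_card]
    exact h1
  conv_rhs => rw [← h2]
  refine Finset.card_nbij' (fun y => y / z) (fun u => u * z) ?_ ?_ ?_ ?_
  · intro y hy
    simp only [Finset.coe_filter, Finset.mem_univ, true_and, Set.mem_setOf_eq] at hy ⊢
    rw [div_pow, hy, div_self']
  · intro y hy
    simp only [Finset.coe_filter, Finset.mem_univ, true_and, Set.mem_setOf_eq] at hy ⊢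
    rw [mul_pow, hy, one_mul]
  · intro y _; simp
  · intro y _; simp

lemma char_fibre (n m : ℕ) (hn : 0 < n) (hm : 0 < m) (h : Fintype.card E = n * m + 1)
    (ψ : MulChar E ℂ) (hψ : ψ ^ n = 1) (y z : Eˣ) (hyz : z ^ m = y ^ m) : ψ y = ψ z := by
  have hc : Nat.card Eˣ = n * m := by
    rw [Nat.card_eq_fintype_card, Fintype.card_units, h]; simp
  have h1 := IsCyclic.card_powMonoidHom_ker (G := Eˣ) m
  have h2 := IsCyclic.card_powMonoidHom_range (G := Eˣ) n
  rw [hc, Nat.gcd_eq_right (Dvd.intro_left _ rfl)] at h1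
  rw [hc, Nat.gcd_eq_right (Dvd.intro _ rfl), Nat.mul_div_cancel_left _ hn] at h2
  have hle : (powMonoidHom n : Eˣ →* Eˣ).range ≤ (powMonoidHom m : Eˣ →* Eˣ).ker := by
    rintro _ ⟨w, rfl⟩
    rw [MonoidHom.mem_ker]
    simp only [powMonoidHom_apply]
    rw [← pow_mul, ← hc, pow_card_eq_one']
  have heq := Subgroup.eq_of_le_of_card_ge hle (by rw [h1, h2])
  have hmem : y / z ∈ (powMonoidHom m : Eˣ →* Eˣ).ker := by
    rw [MonoidHom.mem_ker, powMonoidHom_apply, div_pow, hyz, div_self']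
  rw [← heq] at hmem
  obtain ⟨w, hw⟩ := hmem
  have : y = w ^ n * z := by
    rw [← powMonoidHom_apply, hw, div_mul_cancel]
  rw [this, Units.val_mul, map_mul, Units.val_pow_eq_pow_val, map_pow, ← MulChar.pow_apply_coe, hψ,
    MulChar.one_apply_coe, one_mul]

theorem charsum_bound (p : ℕ) [Fact p.Prime] [CharP E p] (s M n e d : ℕ) (hMp : M = p ^ s)
    (hQ : Fintype.card E = M ^ 2) (hn : 0 < n) (hM : n * e + 1 = M)
    (f : E[X]) (hf : f.Monic) (hd : f.natDegree = d) (hcop : d.Coprime n)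
    (hlarge : 2 * (2 + d * n) ≤ M) (ψ : MulChar E ℂ) (hψ : ψ ^ n = 1) (hψ1 : ψ ≠ 1) :
    ‖∑ x, ψ (f.eval x)‖ ≤ (n * (4 * d + 5) + d) * M := by
  set m := e * (M + 1) with hm
  have he : 0 < e := by
    rcases Nat.eq_zero_or_pos e with h | h
    · subst h; omega
    · exact h
  have hmpos : 0 < m := by positivity
  have hcard : Fintype.card E = n * m + 1 := by
    rw [hQ, hm, ← mul_assoc, show n * e = M - 1 by omega]
    obtain ⟨M', rfl⟩ : ∃ M', M = M' + 1 := ⟨M - 1, by omega⟩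
    simp; ring
  set U : ℕ := (e + 4 * d + 5) * M with hU
  let N : Eˣ → ℕ := fun y => (univ.filter fun x : E => f.eval x ^ m = (y : E) ^ m).card
  have hN : ∀ y, N y ≤ U := fun y =>
    stepanov p s M n e d hMp hQ hn hM f hf hd hcop hlarge _ (pow_ne_zero _ y.ne_zero)
  have hNsum : ∀ y, (N y : ℂ) = ∑ x : E, if f.eval x ^ m = (y : E) ^ m then (1 : ℂ) else 0 := by
    intro y; simp [N]
  have hfib : ∀ x : E, ∀ g : Eˣ → ℂ, (∀ y z : Eˣ, z ^ m = y ^ m → g y = g z) →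
      ∀ c : ℂ, (∀ h : f.eval x ≠ 0, g (Units.mk0 _ h) = c) → (f.eval x = 0 → c = 0) →
      (∑ y : Eˣ, g y * if f.eval x ^ m = (y : E) ^ m then (1 : ℂ) else 0) = m * c := by
    intro x g hg c hc hc0
    by_cases h : f.eval x = 0
    · rw [hc0 h, h, mul_zero]
      refine Finset.sum_eq_zero fun y _ => ?_
      rw [if_neg, mul_zero]
      rw [zero_pow hmpos.ne']
      exact (pow_ne_zero _ y.ne_zero).symm
    · have hiff : ∀ y : Eˣ, f.eval x ^ m = (y : E) ^ m ↔ (Units.mk0 _ h) ^ m = y ^ m := by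
        intro y
        rw [Units.ext_iff]; simp
      simp only [hiff, mul_ite, mul_one, mul_zero]
      rw [← Finset.sum_filter, Finset.sum_congr rfl (g := fun _ => c), Finset.sum_const,
        card_fibre n m hn hmpos hcard, nsmul_eq_mul]
      intro y hy
      rw [mem_filter] at hy
      rw [hg y _ hy.2, hc]
  have hT : ∑ y : Eˣ, ψ y * ((N y : ℂ) - U) = m * ∑ x, ψ (f.eval x) := by
    have h0 : ∑ y : Eˣ, ψ y = 0 := by
      rcases MulChar.ne_one_iff.mp hψ1 with ⟨b, hb⟩
      refine eq_zero_of_mul_eq_self_left hb ?_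
      simpa only [Finset.mul_sum, ← map_mul, Units.val_mul] using
        (Group.mulLeft_bijective b).sum_comp fun y : Eˣ => ψ (y : E)
    simp only [mul_sub]
    rw [Finset.sum_sub_distrib, ← Finset.sum_mul, h0, zero_mul, sub_zero]
    simp only [hNsum, Finset.mul_sum]
    rw [Finset.sum_comm]
    refine Finset.sum_congr rfl fun x _ => ?_
    refine hfib x (fun y => ψ y) (fun y z h => char_fibre n m hn hmpos hcard ψ hψ y z h) _ ?_ ?_
    · intro h; rfl
    · intro h; rw [h]; exact ψ.map_zero
  set Z := (univ.filter fun x : E => f.eval x = 0).card with hZ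
  have hZd : Z ≤ d := by
    rw [← hd]
    refine le_trans ?_ (card_roots' f)
    refine le_trans ?_ (Multiset.toFinset_card_le _)
    refine Finset.card_le_card fun x hx => ?_
    rw [mem_filter] at hx
    rw [Multiset.mem_toFinset, mem_roots hf.ne_zero]
    exact hx.2
  have hNtot : ∑ y : Eˣ, (N y : ℝ) = m * (M ^ 2 - Z) := by
    have : ∑ y : Eˣ, (N y : ℂ) = m * (M ^ 2 - Z) := by
      simp only [hNsum]
      rw [Finset.sum_comm]
      have : ∀ x : E, (∑ y : Eˣ, if f.eval x ^ m = (y : E) ^ m then (1 : ℂ) else 0)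
          = m * (1 - if f.eval x = 0 then 1 else 0) := by
        intro x
        have := hfib x (fun _ => 1) (fun _ _ _ => rfl) (1 - if f.eval x = 0 then 1 else 0)
          (fun h => by simp [h]) (fun h => by simp [h])
        simpa using this
      simp only [this]
      rw [← Finset.mul_sum, Finset.sum_sub_distrib]
      simp [hZ, hQ]
    exact_mod_cast this
  have hfin : (m : ℝ) * ‖∑ x, ψ (f.eval x)‖ ≤ m * (n * U - (M ^ 2 - Z)) := by
    calc (m : ℝ) * ‖∑ x, ψ (f.eval x)‖ = ‖∑ y : Eˣ, ψ y * ((N y : ℂ) - U)‖ := by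
          rw [hT, norm_mul]; simp
      _ ≤ ∑ y : Eˣ, ‖ψ y * ((N y : ℂ) - U)‖ := norm_sum_le _ _
      _ ≤ ∑ y : Eˣ, ((U : ℝ) - N y) := by
          refine Finset.sum_le_sum fun y _ => ?_
          rw [norm_mul, norm_mulChar_eq ψ _ y.ne_zero, one_mul]
          have : ((N y : ℂ) - U) = (((N y : ℝ) - U : ℝ) : ℂ) := by push_cast; rfl
          rw [this, Complex.norm_real, Real.norm_eq_abs, abs_sub_comm, abs_of_nonneg]
          have := hN y
          rw [sub_nonneg]; exact_mod_cast this
      _ = m * (n * U - (M ^ 2 - Z)) := by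
          rw [Finset.sum_sub_distrib, hNtot]
          simp only [sum_const, card_univ, Fintype.card_units, hcard]
          simp only [Nat.add_sub_cancel, nsmul_eq_mul]
          push_cast
          ring
  have hmR : (0 : ℝ) < m := by exact_mod_cast hmpos
  have h1 := le_of_mul_le_mul_left hfin hmR
  refine h1.trans ?_
  have hMR : (n : ℝ) * e + 1 = M := by exact_mod_cast hM
  have hM1 : (1 : ℝ) ≤ M := by
    have : 1 ≤ M := by omega
    exact_mod_cast this
  have hZR : (Z : ℝ) ≤ d := by exact_mod_cast hZd
  have hdR : (d : ℝ) ≤ d * M := by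
    have : (0 : ℝ) ≤ d := by positivity
    nlinarith
  have e1 : (n : ℝ) * U = (M - 1) * M + n * (4 * d + 5) * M := by
    rw [hU, ← hMR]; push_cast; rw [← hMR]; ring
  rw [e1]
  nlinarith
end

section
open Filter Topology

lemma eval_hasSum (P : ℂ[X]) (u : ℂ) : HasSum (fun r => P.coeff r * u ^ r) (P.eval u) := by
  rw [eval_eq_sum_range]
  refine hasSum_sum_of_ne_finset_zero fun r hr => ?_
  rw [coeff_eq_zero_of_natDegree_lt, zero_mul]
  have := Finset.mem_range.not.1 hr
  omega

lemma eval_identity (H : ℂ[X]) (T : ℕ → ℂ) (u : ℂ) (hT : Summable fun r => ‖T r * u ^ r‖)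
    (hrec : ∀ r : ℕ, (r : ℂ) * H.coeff r = ∑ x ∈ antidiagonal r, H.coeff x.1 * T x.2) :
    u * H.derivative.eval u = H.eval u * ∑' r, T r * u ^ r := by
  have h1 := eval_hasSum (X * H.derivative) u
  rw [eval_mul, eval_X] at h1
  rw [← h1.tsum_eq, ← (eval_hasSum H u).tsum_eq]
  have hH : Summable fun r => ‖H.coeff r * u ^ r‖ := by
    refine summable_of_ne_finset_zero (s := range (H.natDegree + 1)) fun r hr => ?_
    rw [coeff_eq_zero_of_natDegree_lt, zero_mul, norm_zero]
    have := Finset.mem_range.not.1 hr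
    omega
  rw [tsum_mul_tsum_eq_tsum_sum_antidiagonal_of_summable_norm hH hT]
  refine tsum_congr fun r => ?_
  have : (X * derivative H).coeff r = r * H.coeff r := by
    cases r with
    | zero => simp
    | succ k => rw [coeff_X_mul, coeff_derivative]; push_cast; ring
  rw [this, hrec, Finset.sum_mul]
  refine Finset.sum_congr rfl fun x hx => ?_
  rw [← mem_antidiagonal.1 hx, pow_add]; ring

lemma no_small_root (H : ℂ[X]) (T : ℕ → ℂ) (ρ K : ℝ) (hρ : 0 < ρ) (hH0 : H.coeff 0 = 1)
    (hT : ∀ r, ‖T r‖ ≤ K * ρ ^ r)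
    (hrec : ∀ r : ℕ, (r : ℂ) * H.coeff r = ∑ x ∈ antidiagonal r, H.coeff x.1 * T x.2)
    (u : ℂ) (hu : H.eval u = 0) : 1 ≤ ρ * ‖u‖ := by
  by_contra hlt
  push Not at hlt
  have hHne : H ≠ 0 := by rintro rfl; simp at hH0
  have hu0 : u ≠ 0 := by
    rintro rfl
    rw [← coeff_zero_eq_eval_zero, hH0] at hu
    exact one_ne_zero hu
  have hsum : Summable fun r => ‖T r‖ * ‖u‖ ^ r := by
    refine Summable.of_nonneg_of_le (fun r => by positivity) (fun r => ?_)
      ((summable_geometric_of_lt_one (by positivity) hlt).mul_left K)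
    calc ‖T r‖ * ‖u‖ ^ r ≤ K * ρ ^ r * ‖u‖ ^ r :=
          mul_le_mul_of_nonneg_right (hT r) (by positivity)
      _ = K * (ρ * ‖u‖) ^ r := by rw [mul_pow]; ring
  set B := ∑' r, ‖T r‖ * ‖u‖ ^ r with hB
  obtain ⟨R, hR, hRu⟩ := exists_eq_pow_rootMultiplicity_mul_and_not_dvd H hHne u
  set k := rootMultiplicity u H with hk
  have hkpos : 0 < k := (rootMultiplicity_pos hHne).2 hu
  have hRe : R.eval u ≠ 0 := by
    intro h; exact hRu (dvd_iff_isRoot.2 h)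
  obtain ⟨j, hj⟩ : ∃ j, k = j + 1 := ⟨k - 1, by omega⟩
  -- the polynomial identity
  let P : ℂ[X] := X * (C (k : ℂ) * R + (X - C u) * derivative R)
  have hder : X * derivative H = (X - C u) ^ j * P := by
    conv_lhs => rw [hR, hj]
    simp only [P]
    rw [derivative_mul, derivative_X_sub_C_pow, hj]
    simp only [Nat.add_sub_cancel]
    ring
  have hPe : P.eval u ≠ 0 := by
    simp only [P, eval_mul, eval_X, eval_add, eval_C, eval_sub, sub_self, zero_mul, add_zero]
    have : (k : ℂ) ≠ 0 := by exact_mod_cast hkpos.ne'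
    exact mul_ne_zero hu0 (mul_ne_zero this hRe)
  have hbd : ∀ v : ℂ, ‖v‖ ≤ ‖u‖ → v ≠ u → ‖P.eval v‖ ≤ ‖v - u‖ * ‖R.eval v‖ * B := by
    intro v hv hvu
    have hle : ∀ r, ‖T r * v ^ r‖ ≤ ‖T r‖ * ‖u‖ ^ r := by
      intro r
      rw [norm_mul, norm_pow]
      gcongr
    have hs : Summable fun r => ‖T r * v ^ r‖ :=
      Summable.of_nonneg_of_le (fun r => norm_nonneg _) hle hsum
    have hid := eval_identity H T v hs hrec
    have h1 : v * H.derivative.eval v = (v - u) ^ j * P.eval v := by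
      have := congrArg (eval v) hder
      simpa using this
    have h2 : H.eval v = (v - u) ^ j * ((v - u) * R.eval v) := by
      have := congrArg (eval v) hR
      rw [this, hj]; simp [pow_succ]; ring
    rw [h1, h2, mul_assoc] at hid
    have h3 := mul_left_cancel₀ (pow_ne_zero j (sub_ne_zero.2 hvu)) hid
    rw [h3, norm_mul, norm_mul]
    refine mul_le_mul_of_nonneg_left ?_ (by positivity)
    refine (norm_tsum_le_tsum_norm hs).trans ?_
    exact hs.tsum_le_tsum hle hsum
  let v : ℕ → ℂ := fun t => u * (1 - ((1 / ((t : ℝ) + 1) : ℝ) : ℂ))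
  have hvlim : Tendsto v atTop (𝓝 u) := by
    have h1 : Tendsto (fun t : ℕ => ((1 / ((t : ℝ) + 1) : ℝ) : ℂ)) atTop (𝓝 ((0 : ℝ) : ℂ)) :=
      (Complex.continuous_ofReal.tendsto 0).comp tendsto_one_div_add_atTop_nhds_zero_nat
    have := (h1.const_sub 1).const_mul u
    simpa [v] using this
  have hvbd : ∀ t, ‖P.eval (v t)‖ ≤ ‖v t - u‖ * ‖R.eval (v t)‖ * B := by
    intro t
    have ht : (0 : ℝ) < (t : ℝ) + 1 := by positivity
    have ht1 : 1 / ((t : ℝ) + 1) ≤ 1 := by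
      rw [div_le_one ht]; linarith [(Nat.cast_nonneg t : (0 : ℝ) ≤ t)]
    have ht0 : 0 < 1 / ((t : ℝ) + 1) := by positivity
    apply hbd
    · simp only [v]
      rw [norm_mul, ← Complex.ofReal_one, ← Complex.ofReal_sub, Complex.norm_real,
        Real.norm_eq_abs, abs_of_nonneg (by linarith)]
      have := norm_nonneg u
      nlinarith
    · intro h
      simp only [v] at h
      have h' : u * ((1 / ((t : ℝ) + 1) : ℝ) : ℂ) = 0 := by linear_combination -h
      rcases mul_eq_zero.1 h' with h | h
      · exact hu0 h
      · exact ht0.ne' (by exact_mod_cast h)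
  have hl1 : Tendsto (fun t => ‖P.eval (v t)‖) atTop (𝓝 ‖P.eval u‖) :=
    ((P.continuous.tendsto u).comp hvlim).norm
  have hl2 : Tendsto (fun t => ‖v t - u‖ * ‖R.eval (v t)‖ * B) atTop
      (𝓝 (‖u - u‖ * ‖R.eval u‖ * B)) :=
    (((hvlim.sub_const u).norm).mul ((R.continuous.tendsto u).comp hvlim).norm).mul_const B
  have := le_of_tendsto_of_tendsto' hl1 hl2 hvbd
  simp only [sub_self, norm_zero, zero_mul] at this
  exact hPe (norm_le_zero_iff.1 this)

theorem coeff_one_bound (a S : ℕ → ℂ) (m : ℕ) (ρ K : ℝ) (hρ : 0 < ρ) (ha0 : a 0 = 1)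
    (ham : ∀ D, m ≤ D → a D = 0)
    (hrec : ∀ D : ℕ, (D : ℂ) * a D = ∑ x ∈ antidiagonal D, a x.1 * S x.2)
    (hS : ∀ r, ‖S (2 * r)‖ ≤ K * ρ ^ (2 * r)) : ‖a 1‖ ≤ m * ρ := by
  let L : ℂ[X] := ∑ i ∈ range m, C (a i) * X ^ i
  have hLc : ∀ i, L.coeff i = a i := by
    intro i
    simp only [L, finsetSum_coeff, coeff_C_mul, coeff_X_pow]
    by_cases hi : i < m
    · simp [hi]
    · rw [ham i (by omega)]
      simp; omega
  have hLdeg : L.natDegree ≤ m := by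
    refine natDegree_sum_le_of_forall_le _ _ fun i hi => ?_
    exact (natDegree_C_mul_X_pow_le _ _).trans (mem_range.1 hi).le
  let L' : ℂ[X] := L.comp (C (-1) * X)
  have hL'c : ∀ i, L'.coeff i = (-1) ^ i * a i := by
    intro i
    simp only [L']
    rw [comp_C_mul_X_coeff, hLc, mul_comm]
  let H := L * L'
  let T : ℕ → ℂ := fun r => S r + (-1) ^ r * S r
  have hKnn : 0 ≤ K := by
    have := (norm_nonneg _).trans (hS 0)
    simpa using this
  have hT : ∀ r, ‖T r‖ ≤ (2 * K) * ρ ^ r := by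
    intro r
    rcases Nat.even_or_odd' r with ⟨k, rfl | rfl⟩
    · have : T (2 * k) = 2 * S (2 * k) := by simp [T]; ring
      rw [this, norm_mul]
      have := hS k
      simp only [Complex.norm_ofNat]
      linarith
    · have : T (2 * k + 1) = 0 := by simp [T, pow_succ]
      rw [this, norm_zero]; positivity
  -- power series identities
  let Lp : PowerSeries ℂ := L
  let Lp' : PowerSeries ℂ := L'
  have hp1 : (PowerSeries.X * PowerSeries.derivative ℂ Lp) = Lp * PowerSeries.mk S := by
    ext D
    have h2 : PowerSeries.coeff D (Lp * PowerSeries.mk S) = ∑ x ∈ antidiagonal D, a x.1 * S x.2 := by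
      rw [PowerSeries.coeff_mul]
      simp [Lp, hLc]
    rw [h2, ← hrec]
    cases D with
    | zero => simp
    | succ k =>
      rw [PowerSeries.coeff_succ_X_mul, PowerSeries.coeff_derivative]
      simp [Lp, hLc]; ring
  have hp2 : (PowerSeries.X * PowerSeries.derivative ℂ Lp')
      = Lp' * PowerSeries.mk (fun r => (-1) ^ r * S r) := by
    ext D
    have h2 : PowerSeries.coeff D (Lp' * PowerSeries.mk (fun r => (-1) ^ r * S r))
        = (-1) ^ D * ∑ x ∈ antidiagonal D, a x.1 * S x.2 := by
      rw [PowerSeries.coeff_mul, Finset.mul_sum]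
      refine Finset.sum_congr rfl fun x hx => ?_
      rw [← mem_antidiagonal.1 hx]
      simp [Lp', hL'c, pow_add]; ring
    rw [h2, ← hrec]
    cases D with
    | zero => simp
    | succ k =>
      rw [PowerSeries.coeff_succ_X_mul, PowerSeries.coeff_derivative]
      simp [Lp', hL'c]; ring
  have hp3 : PowerSeries.X * PowerSeries.derivative ℂ (Lp * Lp') = (Lp * Lp') * PowerSeries.mk T := by
    have : PowerSeries.mk T = PowerSeries.mk S + PowerSeries.mk (fun r => (-1) ^ r * S r) := by
      ext r; simp [T]
    rw [this, Derivation.leibniz]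
    simp only [smul_eq_mul]
    linear_combination Lp' * hp1 + Lp * hp2
  have hHrec : ∀ r : ℕ, (r : ℂ) * H.coeff r = ∑ x ∈ antidiagonal r, H.coeff x.1 * T x.2 := by
    intro r
    have hcoe : ∀ i, PowerSeries.coeff i (Lp * Lp') = H.coeff i := by
      intro i
      simp only [Lp, Lp', H]
      rw [← Polynomial.coe_mul, Polynomial.coeff_coe]
    have := congrArg (PowerSeries.coeff r) hp3
    have hR : PowerSeries.coeff r ((Lp * Lp') * PowerSeries.mk T)
        = ∑ x ∈ antidiagonal r, H.coeff x.1 * T x.2 := by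
      rw [PowerSeries.coeff_mul]
      simp only [hcoe, PowerSeries.coeff_mk]
    rw [← hR, ← this]
    cases r with
    | zero => rw [PowerSeries.coeff_zero_X_mul]; simp
    | succ k =>
      rw [PowerSeries.coeff_succ_X_mul, PowerSeries.coeff_derivative, hcoe]
      push_cast; ring
  have hH0 : H.coeff 0 = 1 := by
    simp only [H]
    rw [mul_coeff_zero, hLc, hL'c, ha0]; simp
  have hroots : ∀ u, L.eval u = 0 → 1 ≤ ρ * ‖u‖ := fun u hu =>
    no_small_root H T ρ (2 * K) hρ hH0 hT hHrec u (by simp [H, hu])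
  have hL0 : L.eval 0 = 1 := by rw [← coeff_zero_eq_eval_zero, hLc, ha0]
  have hsp := (IsAlgClosed.splits L).eval_derivative_div_eval_of_ne_zero (x := 0)
    (by rw [hL0]; exact one_ne_zero)
  have ha1 : L.derivative.eval 0 = a 1 := by
    rw [← coeff_zero_eq_eval_zero, coeff_derivative, hLc]; simp
  rw [hL0, ha1, div_one] at hsp
  have hLne : L ≠ 0 := by rintro h; rw [h] at hL0; simp at hL0
  rw [hsp]
  have hm : ∀ s : Multiset ℂ, (∀ z ∈ s, 1 ≤ ρ * ‖z‖) →
      ‖(s.map fun z => 1 / (0 - z)).sum‖ ≤ s.card * ρ := by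
    intro s
    induction s using Multiset.induction_on with
    | empty => simp
    | cons z s ih =>
      intro h
      rw [Multiset.map_cons, Multiset.sum_cons, Multiset.card_cons]
      refine (norm_add_le _ _).trans ?_
      have h1 := ih fun w hw => h w (Multiset.mem_cons_of_mem hw)
      have h2 := h z (Multiset.mem_cons_self z s)
      have h3 : ‖1 / (0 - z)‖ ≤ ρ := by
        rw [norm_div, zero_sub, norm_neg, norm_one]
        have : 0 < ‖z‖ := by
          by_contra h0
          have : ‖z‖ = 0 := le_antisymm (not_lt.1 h0) (norm_nonneg _)
          rw [this] at h2; linarith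
        rw [div_le_iff₀ this]; exact h2
      push_cast
      linarith
  refine (hm L.roots fun z hz => hroots z ((mem_roots hLne).1 hz)).trans ?_
  refine mul_le_mul_of_nonneg_right ?_ hρ.le
  exact_mod_cast (card_roots' L).trans hLdeg
end

section
variable {F : Type*} [Field F] [Fintype F]

lemma monic_finite (D : ℕ) : {g : F[X] | g.Monic ∧ g.natDegree = D}.Finite := by
  refine Set.Finite.of_injOn (f := fun g : F[X] => fun k : Fin (D + 1) => g.coeff k)
    (t := Set.univ) (fun _ _ => Set.mem_univ _) ?_ Set.finite_univ
  intro g hg h hh hgh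
  ext k
  by_cases hk : k < D + 1
  · exact congrFun hgh ⟨k, hk⟩
  · rw [coeff_eq_zero_of_natDegree_lt (by have := hg.2; omega),
      coeff_eq_zero_of_natDegree_lt (by have := hh.2; omega)]

/-- monic polynomials of degree `D` -/
noncomputable def Mon (F : Type*) [Field F] [Fintype F] (D : ℕ) : Finset F[X] :=
  (monic_finite (F := F) D).toFinset

lemma mem_Mon {D : ℕ} {g : F[X]} : g ∈ Mon F D ↔ g.Monic ∧ g.natDegree = D := by
  simp [Mon]

open Classical in
/-- monic irreducible polynomials of degree at most `D` -/
noncomputable def Irr (F : Type*) [Field F] [Fintype F] (D : ℕ) : Finset F[X] :=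
  ((range (D + 1)).biUnion (Mon F)).filter Irreducible

lemma mem_Irr {D : ℕ} {g : F[X]} : g ∈ Irr F D ↔ g.Monic ∧ g.natDegree ≤ D ∧ Irreducible g := by
  simp only [Irr, mem_filter, mem_biUnion, mem_range, mem_Mon]
  constructor
  · rintro ⟨⟨i, hi, h1, h2⟩, h3⟩
    exact ⟨h1, by omega, h3⟩
  · rintro ⟨h1, h2, h3⟩
    exact ⟨⟨g.natDegree, by omega, h1, rfl⟩, h3⟩

open Classical in
lemma degree_identity (D : ℕ) (g : F[X]) (hg : g.Monic) (hD : g.natDegree = D) :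
    ∑ P ∈ Irr F D, ∑ k ∈ Icc 1 D, (if P ^ k ∣ g then P.natDegree else 0) = D := by
  have hg0 := hg.ne_zero
  set s := UniqueFactorizationMonoid.normalizedFactors g with hs
  have hmem : ∀ P ∈ s, P.Monic ∧ P.natDegree ≤ D ∧ Irreducible P := by
    intro P hP
    have hirr := UniqueFactorizationMonoid.irreducible_of_normalized_factor P hP
    have hdvd := UniqueFactorizationMonoid.dvd_of_mem_normalizedFactors hP
    refine ⟨?_, ?_, hirr⟩
    · have := UniqueFactorizationMonoid.normalize_normalized_factor P hP
      rw [← this]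
      exact monic_normalize hirr.ne_zero
    · rw [← hD]; exact natDegree_le_of_dvd hdvd hg0
  have hprod : s.prod = g := by
    have h1 : Associated s.prod g := UniqueFactorizationMonoid.prod_normalizedFactors hg0
    refine eq_of_monic_of_associated ?_ hg h1
    exact monic_multiset_prod_of_monic s id (fun P hP => (hmem P hP).1) |> fun h => by simpa using h
  have hdeg : D = (s.map natDegree).sum := by
    rw [← hD]
    conv_lhs => rw [← hprod]
    exact natDegree_multiset_prod_of_monic s (fun P hP => (hmem P hP).1)
  rw [Finset.sum_multiset_map_count] at hdeg
  conv_rhs => rw [hdeg]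
  have hsub : s.toFinset ⊆ Irr F D := by
    intro P hP
    exact mem_Irr.2 (hmem P (Multiset.mem_toFinset.1 hP))
  rw [Finset.sum_subset hsub (f := fun P => s.count P • P.natDegree)]
  · refine Finset.sum_congr rfl fun P hP => ?_
    rw [mem_Irr] at hP
    have hdvd : ∀ k, P ^ k ∣ g ↔ k ≤ s.count P := by
      intro k
      rw [Multiset.le_count_iff_replicate_le]
      have := UniqueFactorizationMonoid.le_emultiplicity_iff_replicate_le_normalizedFactors
        (n := k) hP.2.2 hg0
      rw [← pow_dvd_iff_le_emultiplicity, hP.1.normalize_eq_self] at this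
      exact this
    simp only [hdvd]
    rw [← Finset.sum_filter, Finset.sum_const]
    congr 1
    have hcD : s.count P ≤ D := by
      by_cases hc : s.count P = 0
      · omega
      · have h1 : P ^ s.count P ∣ g := (hdvd _).2 le_rfl
        have h2 := natDegree_le_of_dvd h1 hg0
        rw [natDegree_pow, hD] at h2
        have := hP.2.2.natDegree_pos
        nlinarith
    have : (Icc 1 D).filter (fun k => k ≤ s.count P) = Icc 1 (s.count P) := by
      ext k; simp only [mem_filter, mem_Icc]; omega
    rw [this]; simp
  · intro P _ hP
    rw [Multiset.mem_toFinset] at hP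
    simp [Multiset.count_eq_zero_of_notMem hP]

variable {ι : Type*} [Fintype ι]

/-- the multiplicative function on polynomials attached to points and characters -/
noncomputable def Lam (c : ι → F) (χ : ι → MulChar F ℂ) (g : F[X]) : ℂ := ∏ i, χ i (g.eval (c i))

lemma Lam_mul (c : ι → F) (χ : ι → MulChar F ℂ) (g h : F[X]) :
    Lam c χ (g * h) = Lam c χ g * Lam c χ h := by
  simp [Lam, Finset.prod_mul_distrib]

lemma Lam_one (c : ι → F) (χ : ι → MulChar F ℂ) : Lam c χ 1 = 1 := by
  simp [Lam]

lemma Lam_pow (c : ι → F) (χ : ι → MulChar F ℂ) (g : F[X]) (k : ℕ) :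
    Lam c χ (g ^ k) = Lam c χ g ^ k := by
  induction k with
  | zero => simp [Lam_one]
  | succ k ih => rw [pow_succ, Lam_mul, ih, pow_succ]

/-- coefficient of the L-function -/
noncomputable def aCoef (c : ι → F) (χ : ι → MulChar F ℂ) (D : ℕ) : ℂ :=
  ∑ g ∈ Mon F D, Lam c χ g

/-- power sums of the L-function -/
noncomputable def sCoef (c : ι → F) (χ : ι → MulChar F ℂ) (r : ℕ) : ℂ :=
  ∑ P ∈ Irr F r, ∑ k ∈ Icc 1 r,
    (if k * P.natDegree = r then (P.natDegree : ℂ) * Lam c χ P ^ k else 0)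

lemma sCoef_eq (c : ι → F) (χ : ι → MulChar F ℂ) (r N : ℕ) (h : r ≤ N) :
    sCoef c χ r = ∑ P ∈ Irr F N, ∑ k ∈ Icc 1 N,
      (if k * P.natDegree = r then (P.natDegree : ℂ) * Lam c χ P ^ k else 0) := by
  have hsub : Irr F r ⊆ Irr F N := by
    intro P; simp only [mem_Irr]; rintro ⟨h1, h2, h3⟩; exact ⟨h1, h2.trans h, h3⟩
  have hI : Icc 1 r ⊆ Icc 1 N := Finset.Icc_subset_Icc le_rfl h
  unfold sCoef
  rw [← Finset.sum_subset hsub]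
  · refine Finset.sum_congr rfl fun P hP => ?_
    have hpos := (mem_Irr.1 hP).2.2.natDegree_pos
    refine Finset.sum_subset hI fun k hk hk' => ?_
    rw [if_neg]
    simp only [mem_Icc] at hk hk'
    intro h
    have : k ≤ r := by nlinarith
    omega
  · intro P hP hP'
    refine Finset.sum_eq_zero fun k hk => ?_
    rw [if_neg]
    rw [mem_Irr] at hP hP'
    rw [mem_Icc] at hk
    intro h
    apply hP'
    refine ⟨hP.1, ?_, hP.2.2⟩
    nlinarith

open Classical in
lemma sum_dvd (c : ι → F) (χ : ι → MulChar F ℂ) (D : ℕ) (R : F[X]) (hR : R.Monic) :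
    ∑ g ∈ Mon F D, (if R ∣ g then Lam c χ g else 0)
      = if R.natDegree ≤ D then Lam c χ R * aCoef c χ (D - R.natDegree) else 0 := by
  split_ifs with h
  · unfold aCoef
    rw [← Finset.sum_filter, Finset.mul_sum]
    symm
    refine Finset.sum_bij (fun h _ => R * h) ?_ ?_ ?_ ?_
    · intro h' hh
      rw [mem_Mon] at hh
      rw [mem_filter, mem_Mon]
      refine ⟨⟨hR.mul hh.1, ?_⟩, Dvd.intro _ rfl⟩
      rw [hR.natDegree_mul hh.1, hh.2]; omega
    · intro a _ b _ hab
      exact mul_left_cancel₀ hR.ne_zero hab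
    · intro g hg
      rw [mem_filter, mem_Mon] at hg
      obtain ⟨⟨hg1, hg2⟩, h', rfl⟩ := hg
      have hm : h'.Monic := hR.of_mul_monic_left hg1
      refine ⟨h', ?_, rfl⟩
      rw [mem_Mon]
      refine ⟨hm, ?_⟩
      rw [hR.natDegree_mul hm] at hg2; omega
    · intro a _
      rw [Lam_mul]
  · refine Finset.sum_eq_zero fun g hg => ?_
    rw [if_neg]
    intro hd
    rw [mem_Mon] at hg
    have := natDegree_le_of_dvd hd hg.1.ne_zero
    omega

open Classical in
theorem newton (c : ι → F) (χ : ι → MulChar F ℂ) (D : ℕ) :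
    (D : ℂ) * aCoef c χ D = ∑ x ∈ antidiagonal D, aCoef c χ x.1 * sCoef c χ x.2 := by
  have h1 : (D : ℂ) * aCoef c χ D = ∑ P ∈ Irr F D, ∑ k ∈ Icc 1 D, (P.natDegree : ℂ) *
      ∑ g ∈ Mon F D, (if P ^ k ∣ g then Lam c χ g else 0) := by
    have : ∀ g ∈ Mon F D, (D : ℂ) * Lam c χ g = ∑ P ∈ Irr F D, ∑ k ∈ Icc 1 D,
        (P.natDegree : ℂ) * (if P ^ k ∣ g then Lam c χ g else 0) := by
      intro g hg
      rw [mem_Mon] at hg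
      have := degree_identity D g hg.1 hg.2
      conv_lhs => rw [← this]
      push_cast
      simp only [Finset.sum_mul]
      refine Finset.sum_congr rfl fun P _ => Finset.sum_congr rfl fun k _ => ?_
      split_ifs <;> simp
    unfold aCoef
    rw [Finset.mul_sum, Finset.sum_congr rfl this, Finset.sum_comm]
    refine Finset.sum_congr rfl fun P _ => ?_
    rw [Finset.sum_comm]
    refine Finset.sum_congr rfl fun k _ => ?_
    rw [Finset.mul_sum]
  rw [h1]
  have h2 : ∀ x ∈ antidiagonal D, aCoef c χ x.1 * sCoef c χ x.2 = ∑ P ∈ Irr F D, ∑ k ∈ Icc 1 D,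
      (if k * P.natDegree = x.2 then aCoef c χ x.1 * ((P.natDegree : ℂ) * Lam c χ P ^ k) else 0) := by
    intro x hx
    rw [sCoef_eq c χ x.2 D (by have := mem_antidiagonal.1 hx; omega)]
    simp only [Finset.mul_sum, mul_ite, mul_zero]
  refine Eq.trans ?_ (Finset.sum_congr rfl h2).symm
  conv_rhs => rw [Finset.sum_comm]
  refine Finset.sum_congr rfl fun P hP => ?_
  conv_rhs => rw [Finset.sum_comm]
  refine Finset.sum_congr rfl fun k _ => ?_
  rw [mem_Irr] at hP
  rw [sum_dvd c χ D (P ^ k) (hP.1.pow k), natDegree_pow, Lam_pow]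
  split_ifs with h
  · rw [Finset.sum_eq_single (D - k * P.natDegree, k * P.natDegree)]
    · simp; ring
    · rintro ⟨i, j⟩ hx hne
      rw [if_neg]
      rintro rfl
      apply hne
      have := mem_antidiagonal.1 hx
      simp only at this ⊢
      rw [← this]; simp
    · intro hx
      exfalso; apply hx
      rw [HasAntidiagonal.mem_antidiagonal]; simp; omega
  · rw [mul_zero]
    symm
    refine Finset.sum_eq_zero fun x hx => ?_
    rw [if_neg]
    have := mem_antidiagonal.1 hx
    omega

lemma aCoef_zero (c : ι → F) (χ : ι → MulChar F ℂ) : aCoef c χ 0 = 1 := by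
  have : Mon F 0 = {1} := by
    ext g
    rw [mem_Mon, mem_singleton]
    constructor
    · rintro ⟨h1, h2⟩; exact eq_one_of_monic_natDegree_zero h1 h2
    · rintro rfl; simp
  unfold aCoef
  rw [this, Finset.sum_singleton, Lam_one]

lemma aCoef_one (c : ι → F) (χ : ι → MulChar F ℂ) :
    aCoef c χ 1 = ∑ t : F, ∏ i, χ i (c i - t) := by
  unfold aCoef
  symm
  refine Finset.sum_bij (fun t _ => X - C t) ?_ ?_ ?_ ?_
  · intro t _
    rw [mem_Mon]
    exact ⟨monic_X_sub_C t, natDegree_X_sub_C t⟩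
  · intro a _ b _ h
    simpa using h
  · intro g hg
    rw [mem_Mon] at hg
    refine ⟨-g.coeff 0, mem_univ _, ?_⟩
    rw [hg.1.eq_X_add_C hg.2]; simp
  · intro t _
    simp [Lam]

lemma aCoef_vanish (c : ι → F) (χ : ι → MulChar F ℂ) (u : Fˣ) (hu : ∏ i, χ i u ≠ 1) (D : ℕ)
    (hD : Fintype.card ι ≤ D) : aCoef c χ D = 0 := by
  set R : F[X] := ∏ i, (X - C (c i)) with hR
  have hRm : R.Monic := monic_prod_of_monic _ _ fun i _ => monic_X_sub_C _
  have hRd : R.natDegree = Fintype.card ι := by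
    rw [hR, natDegree_prod_of_monic _ _ fun i _ => monic_X_sub_C _]; simp
  have hRe : ∀ i, R.eval (c i) = 0 := by
    intro i
    rw [hR, eval_prod]
    exact Finset.prod_eq_zero (mem_univ i) (by simp)
  let φ : F → F[X] → F[X] := fun w g => g + C (w - 1) * (g %ₘ R)
  have hmod : ∀ g : F[X], ∀ w i, (φ w g).eval (c i) = w * g.eval (c i) := by
    intro g w i
    have h1 : (g %ₘ R).eval (c i) = g.eval (c i) := by
      conv_rhs => rw [← modByMonic_add_div g R]
      simp [hRe]
    simp only [φ, eval_add, eval_mul, eval_C, h1]; ring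
  have hφmon : ∀ w, ∀ g ∈ Mon F D, φ w g ∈ Mon F D := by
    intro w g hg
    rw [mem_Mon] at hg ⊢
    have hdeg : (C (w - 1) * (g %ₘ R)).degree < g.degree := by
      rw [C_mul']
      refine lt_of_le_of_lt (degree_smul_le _ _) ?_
      refine lt_of_lt_of_le (degree_modByMonic_lt g hRm) ?_
      rw [degree_eq_natDegree hRm.ne_zero, degree_eq_natDegree hg.1.ne_zero, hRd, hg.2]
      exact_mod_cast hD
    refine ⟨hg.1.add_of_left hdeg, ?_⟩
    rw [← hg.2]
    exact natDegree_add_eq_left_of_degree_lt hdeg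
  have hcomp : ∀ w w' : F, w * w' = 1 → ∀ g, φ w (φ w' g) = g := by
    intro w w' hw g
    have h1 : (φ w' g) %ₘ R = C w' * (g %ₘ R) := by
      simp only [φ]
      rw [add_modByMonic, C_mul', C_mul', smul_modByMonic, (modByMonic_eq_self_iff hRm).2
        (degree_modByMonic_lt g hRm), sub_smul, one_smul]
      abel
    change φ w' g + C (w - 1) * (φ w' g %ₘ R) = g
    rw [h1]
    have h2 : (C w * C w' : F[X]) = 1 := by rw [← C_mul, hw, C_1]
    simp only [φ, C_sub, C_1]
    linear_combination (g %ₘ R) * h2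
  have hsum : aCoef c χ D = (∏ i, χ i u) * aCoef c χ D := by
    unfold aCoef
    rw [Finset.mul_sum]
    symm
    refine Finset.sum_nbij' (φ u) (φ ((u⁻¹ : Fˣ) : F)) (hφmon _) (hφmon _) ?_ ?_ ?_
    · intro g _; exact hcomp _ _ (by simp) g
    · intro g _; exact hcomp _ _ (by simp) g
    · intro g _
      simp only [Lam, hmod, map_mul, Finset.prod_mul_distrib]
  by_contra h
  apply hu
  have : (∏ i, χ i u - 1) * aCoef c χ D = 0 := by linear_combination -hsum
  rcases mul_eq_zero.1 this with h' | h'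
  · exact sub_eq_zero.1 h'
  · exact absurd h' h

end

section
variable {F : Type*} [Field F] [Fintype F] {E : Type*} [Field E] [Fintype E] [Algebra F E]

lemma norm_eq_minpoly (x : E) : Algebra.norm F x =
    ((-1) ^ (minpoly F x).natDegree * (minpoly F x).coeff 0) ^
      (Module.finrank (IntermediateField.adjoin F {x}) E) := by
  have hx : IsIntegral F x := Algebra.IsIntegral.isIntegral x
  rw [Algebra.norm_eq_norm_adjoin]
  congr 1
  have := Algebra.PowerBasis.norm_gen_eq_coeff_zero_minpoly
    (IntermediateField.adjoin.powerBasis hx)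
  rw [IntermediateField.adjoin.powerBasis_gen, IntermediateField.minpoly_gen,
    IntermediateField.adjoin.powerBasis_dim] at this
  exact this

lemma norm_sub_eq (x : E) (c : F) : Algebra.norm F (x - algebraMap F E c) =
    ((-1) ^ (minpoly F x).natDegree * (minpoly F x).eval c) ^
      (Module.finrank F E / (minpoly F x).natDegree) := by
  have hx : IsIntegral F x := Algebra.IsIntegral.isIntegral x
  have hy : IsIntegral F (x - algebraMap F E c) := Algebra.IsIntegral.isIntegral _
  rw [norm_eq_minpoly, minpoly.sub_algebraMap]
  have h1 : ((minpoly F x).comp (X + C c)).natDegree = (minpoly F x).natDegree := by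
    rw [natDegree_comp, natDegree_X_add_C, mul_one]
  have h2 := Module.finrank_mul_finrank F
    (IntermediateField.adjoin F {x - algebraMap F E c}) E
  rw [IntermediateField.adjoin.finrank hy, minpoly.sub_algebraMap, h1] at h2
  rw [h1, coeff_zero_eq_eval_zero, eval_comp]
  simp only [eval_add, eval_X, eval_C, zero_add]
  congr 1
  rw [← h2, Nat.mul_div_cancel_left _ (minpoly.natDegree_pos hx)]

open Classical in
lemma fibre_minpoly (P : F[X]) (hP : P.Monic) (hirr : Irreducible P) :
    #{x : E | minpoly F x = P} = if P.natDegree ∣ Module.finrank F E then P.natDegree else 0 := by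
  have hiff : ∀ x : E, minpoly F x = P ↔ aeval x P = 0 := by
    intro x
    constructor
    · rintro rfl; exact minpoly.aeval _ _
    · intro h; exact (minpoly.eq_of_irreducible_of_monic hirr h hP).symm
  split_ifs with h
  · have hd : P ∣ X ^ (Nat.card F) ^ (Module.finrank F E) - X :=
      (Irreducible.natDegree_dvd_iff_dvd_X_pow_card_pow_sub_X hirr).1 h
    have hc : (Nat.card F) ^ (Module.finrank F E) = Fintype.card E := by
      rw [Nat.card_eq_fintype_card, ← Module.card_eq_pow_finrank (K := F) (V := E)]
    rw [hc] at hd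
    have hs := (FiniteField.isSplittingField_sub E F).splits
    have hs' : (P.map (algebraMap F E)).Splits := by
      have h1 : (X ^ Fintype.card E - X : F[X]) ≠ 0 :=
        FiniteField.X_pow_card_sub_X_ne_zero F Fintype.one_lt_card
      have h2 := Polynomial.map_dvd (algebraMap F E) hd
      exact Splits.of_dvd hs (Polynomial.map_ne_zero h1) h2
    rw [← card_rootSet_eq_natDegree (PerfectField.separable_of_irreducible hirr) hs',
      ← Set.toFinset_card]
    congr 1
    ext x
    simp only [mem_filter, mem_univ, true_and, Set.mem_toFinset, hiff, mem_rootSet,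
      ne_eq, hP.ne_zero, not_false_eq_true]
  · rw [card_eq_zero, filter_eq_empty_iff]
    intro x _ hx
    apply h
    rw [← hx]
    exact minpoly.degree_dvd (Algebra.IsIntegral.isIntegral x)

variable {ι : Type*} [Fintype ι]

lemma norm_sum_eq (c : ι → F) (χ : ι → MulChar F ℂ) :
    ∑ x : E, ∏ i, χ i (Algebra.norm F (x - algebraMap F E (c i))) =
      (∏ i, χ i (-1)) ^ (Module.finrank F E) * sCoef c χ (Module.finrank F E) := by
  classical
  obtain ⟨r, hr⟩ : ∃ r, r = Module.finrank F E := ⟨_, rfl⟩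
  rw [← hr]
  have hr0 : 0 < r := hr ▸ Module.finrank_pos
  have hmaps : ∀ x ∈ (univ : Finset E), minpoly F x ∈ Irr F r := by
    intro x _
    have hx : IsIntegral F x := Algebra.IsIntegral.isIntegral x
    exact mem_Irr.2 ⟨minpoly.monic hx, hr ▸ minpoly.natDegree_le x, minpoly.irreducible hx⟩
  rw [← Finset.sum_fiberwise_of_maps_to hmaps]
  unfold sCoef
  rw [Finset.mul_sum]
  refine Finset.sum_congr rfl fun P hP => ?_
  rw [mem_Irr] at hP
  obtain ⟨hm, hdeg, hirr⟩ := hP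
  have hpos := hirr.natDegree_pos
  have hin : ∀ x ∈ ({x : E | minpoly F x = P} : Finset E),
      ∏ i, χ i (Algebra.norm F (x - algebraMap F E (c i))) =
      (((∏ i, χ i (-1)) ^ P.natDegree) * Lam c χ P) ^ (r / P.natDegree) := by
    intro x hx
    rw [mem_filter] at hx
    simp only [norm_sub_eq, hx.2, Lam, map_pow, map_mul, Finset.prod_mul_distrib,
      Finset.prod_pow, hr]
  rw [Finset.sum_congr rfl hin, Finset.sum_const, fibre_minpoly P hm hirr, ← hr]
  split_ifs with h
  · rw [Finset.sum_eq_single (r / P.natDegree)]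
    · rw [if_pos (Nat.div_mul_cancel h), mul_pow, ← pow_mul, Nat.mul_div_cancel' h, nsmul_eq_mul]
      ring
    · intro k _ hk
      rw [if_neg]
      intro hk'
      apply hk
      rw [← hk', Nat.mul_div_cancel _ hpos]
    · intro hk
      exfalso; apply hk
      rw [mem_Icc]
      exact ⟨Nat.div_pos hdeg hpos, Nat.div_le_self _ _⟩
  · rw [zero_smul, Finset.sum_eq_zero, mul_zero]
    intro k _
    rw [if_neg]
    intro hk
    exact h ⟨k, by rw [mul_comm]; exact hk.symm⟩

end

section
variable {F : Type} [Field F] [Fintype F]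

/-- composition of a character with the norm -/
noncomputable def normChar {E : Type} [Field E] [Fintype E] [Algebra F E] (χ : MulChar F ℂ) :
    MulChar E ℂ where
  toMonoidHom := χ.toMonoidHom.comp (Algebra.norm F)
  map_nonunit' := by
    intro a ha
    have ha0 : a = 0 := by
      by_contra h; exact ha (isUnit_iff_ne_zero.2 h)
    subst ha0
    change χ (Algebra.norm F (0 : E)) = 0
    rw [Algebra.norm_zero]
    exact MulChar.map_zero χ

lemma normChar_apply {E : Type} [Field E] [Fintype E] [Algebra F E] (χ : MulChar F ℂ) (x : E) :
    normChar χ x = χ (Algebra.norm F x) := rfl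

lemma exists_ne_one (χ : MulChar F ℂ) (hχ1 : χ ≠ 1) : ∃ u : Fˣ, χ u ≠ 1 := by
  by_contra! h
  apply hχ1
  ext u
  rw [h u, MulChar.one_apply_coe]

lemma pow_val (χ : MulChar F ℂ) (n : ℕ) (hχn : χ ^ n = 1) (u : F) (hu : u ≠ 0) : χ u ^ n = 1 := by
  have := MulChar.pow_apply_coe χ n (Units.mk0 u hu)
  rw [hχn, MulChar.one_apply_coe] at this
  exact this.symm

lemma sCoef_bound_large (χ : MulChar F ℂ) (n : ℕ) (hn : 0 < n) (hχn : χ ^ n = 1) (hχ1 : χ ≠ 1)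
    (hnq : n ∣ Fintype.card F - 1) {ι : Type} [Fintype ι] (c : ι → F) (e : ι → ℕ)
    (he : ∀ i, e i ≠ 0) (hcop : (∑ i, e i).Coprime n) (r : ℕ) (hr : 0 < r)
    (hlarge : 2 * (2 + (∑ i, e i) * n) ≤ Fintype.card F ^ r) :
    ‖sCoef c (fun i => χ ^ e i) (2 * r)‖ ≤
      ((n : ℝ) * (4 * (∑ i, e i : ℕ) + 5) + (∑ i, e i : ℕ)) * (Fintype.card F : ℝ) ^ r := by
  classical
  obtain ⟨p, hp⟩ := CharP.exists F
  obtain ⟨s, hpp, hs⟩ := FiniteField.card F p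
  haveI : Fact p.Prime := ⟨hpp⟩
  haveI : NeZero (2 * r) := ⟨by omega⟩
  set d := ∑ i, e i with hd
  let E := FiniteField.Extension F p (2 * r)
  letI : Fintype E := Fintype.ofFinite E
  haveI : CharP E p := charP_of_injective_algebraMap (algebraMap F E).injective p
  have hfr : Module.finrank F E = 2 * r := FiniteField.finrank_extension F p (2 * r)
  have hcard : Fintype.card E = (Fintype.card F ^ r) ^ 2 := by
    rw [Module.card_eq_pow_finrank (K := F) (V := E), hfr, ← pow_mul, mul_comm]
  have hM : Fintype.card F ^ r = p ^ ((s : ℕ) * r) := by rw [hs, pow_mul]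
  have hdvd : n ∣ Fintype.card F ^ r - 1 := by
    refine hnq.trans ?_
    have := Nat.sub_dvd_pow_sub_pow (Fintype.card F) 1 r
    simpa using this
  obtain ⟨e', he'⟩ := hdvd
  have hMpos : 0 < Fintype.card F ^ r := pow_pos Fintype.card_pos _
  have hM' : n * e' + 1 = Fintype.card F ^ r := by omega
  set f : E[X] := ∏ i, (X - C (algebraMap F E (c i))) ^ e i with hf
  have hfm : f.Monic := monic_prod_of_monic _ _ fun i _ => (monic_X_sub_C _).pow _
  have hfd : f.natDegree = d := by
    rw [hf, natDegree_prod_of_monic _ _ fun i _ => (monic_X_sub_C _).pow _]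
    simp [hd]
  have hψn : (normChar χ : MulChar E ℂ) ^ n = 1 := by
    ext u
    rw [MulChar.pow_apply_coe, MulChar.one_apply_coe, normChar_apply]
    exact pow_val χ n hχn _ (Algebra.norm_ne_zero_iff.2 u.ne_zero)
  have hψ1 : (normChar χ : MulChar E ℂ) ≠ 1 := by
    obtain ⟨u, hu⟩ := exists_ne_one χ hχ1
    obtain ⟨v, hv⟩ := FiniteField.unitsMap_norm_surjective F E u
    intro h
    apply hu
    have h1 : (normChar χ : MulChar E ℂ) v = 1 := by rw [h, MulChar.one_apply_coe]
    rw [normChar_apply] at h1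
    rw [← hv]
    exact h1
  have hb := charsum_bound p (s * r) (Fintype.card F ^ r) n e' d hM hcard hn hM' f hfm hfd hcop
    hlarge (normChar χ) hψn hψ1
  have heq : ∑ x : E, (normChar χ : MulChar E ℂ) (f.eval x) =
      ∑ x : E, ∏ i, (χ ^ e i) (Algebra.norm F (x - algebraMap F E (c i))) := by
    refine Finset.sum_congr rfl fun x _ => ?_
    rw [hf, eval_prod, map_prod]
    refine Finset.prod_congr rfl fun i _ => ?_
    rw [MulChar.pow_apply' _ (he i)]
    simp [normChar_apply]
  rw [heq, norm_sum_eq, norm_mul, norm_pow, norm_prod, hfr] at hb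
  have hone : ∏ i, ‖(χ ^ e i) (-1)‖ = 1 := by
    refine Finset.prod_eq_one fun i _ => norm_mulChar_eq _ _ (by simp)
  rw [hone, one_pow, one_mul] at hb
  push_cast at hb ⊢
  exact hb

theorem weil (χ : MulChar F ℂ) (n : ℕ) (hn : 0 < n) (hχn : χ ^ n = 1) (hχ1 : χ ≠ 1)
    (hnq : n ∣ Fintype.card F - 1) {ι : Type} [Fintype ι] (c : ι → F) (e : ι → ℕ)
    (he : ∀ i, e i ≠ 0) (hcop : (∑ i, e i).Coprime n) :
    ‖∑ t : F, ∏ i, χ (t - c i) ^ e i‖ ≤ (Fintype.card ι + 1 : ℕ) * √(Fintype.card F : ℝ) := by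
  classical
  set q := Fintype.card F with hq
  have hq1 : 1 < q := Fintype.one_lt_card
  set d := ∑ i, e i with hd
  have hqr : (0 : ℝ) < q := by exact_mod_cast (by omega : 0 < q)
  have hsq : ∀ r : ℕ, √(q : ℝ) ^ (2 * r) = (q : ℝ) ^ r := by
    intro r; rw [pow_mul, Real.sq_sqrt hqr.le]
  -- the constant
  obtain ⟨K, hK⟩ : ∃ K : ℝ, ∀ r, ‖sCoef c (fun i => χ ^ e i) (2 * r)‖ ≤ K * √(q : ℝ) ^ (2 * r) := by
    set R := 2 * (2 + d * n) with hR
    set K1 : ℝ := (n : ℝ) * (4 * (d : ℕ) + 5) + (d : ℕ) with hK1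
    have hK1' : 0 ≤ K1 := by positivity
    refine ⟨K1 + ∑ r ∈ range R, ‖sCoef c (fun i => χ ^ e i) (2 * r)‖, fun r => ?_⟩
    rw [hsq]
    have hone : (1 : ℝ) ≤ (q : ℝ) ^ r := one_le_pow₀ (by exact_mod_cast hq1.le)
    have hsum : 0 ≤ ∑ r ∈ range R, ‖sCoef c (fun i => χ ^ e i) (2 * r)‖ :=
      Finset.sum_nonneg fun _ _ => norm_nonneg _
    by_cases hr : r < R
    · have h1 : ‖sCoef c (fun i => χ ^ e i) (2 * r)‖ ≤
          ∑ r ∈ range R, ‖sCoef c (fun i => χ ^ e i) (2 * r)‖ :=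
        Finset.single_le_sum (f := fun r => ‖sCoef c (fun i => χ ^ e i) (2 * r)‖)
          (fun _ _ => norm_nonneg _) (mem_range.2 hr)
      nlinarith
    · have hr' : R ≤ q ^ r := by
        have := Nat.lt_pow_self hq1 (n := r)
        omega
      have h1 := sCoef_bound_large χ n hn hχn hχ1 hnq c e he hcop r (by omega) hr'
      refine h1.trans ?_
      have : (0 : ℝ) ≤ (q : ℝ) ^ r := by positivity
      nlinarith
  obtain ⟨u, hu⟩ := exists_ne_one χ hχ1
  have hu' : ∏ i, (χ ^ e i) (u : F) ≠ 1 := by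
    intro h
    simp only [MulChar.pow_apply_coe] at h
    rw [Finset.prod_pow_eq_pow_sum, ← hd] at h
    have h2 := pow_val χ n hχn u u.ne_zero
    apply hu
    have h3 := (orderOf_dvd_iff_pow_eq_one.2 h)
    have h4 := (orderOf_dvd_iff_pow_eq_one.2 h2)
    have h5 := Nat.dvd_gcd h3 h4
    rw [hcop] at h5
    exact orderOf_eq_one_iff.1 (Nat.dvd_one.1 h5)
  have hmain := coeff_one_bound (aCoef c (fun i => χ ^ e i)) (sCoef c (fun i => χ ^ e i))
    (Fintype.card ι + 1) (√(q : ℝ)) K (Real.sqrt_pos.2 hqr) (aCoef_zero _ _)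
    (fun D hD => aCoef_vanish c _ u hu' D (by omega)) (newton _ _) hK
  rw [aCoef_one] at hmain
  have heq : ∑ t : F, ∏ i, (χ ^ e i) (c i - t) =
      (∏ i, (χ ^ e i) (-1)) * ∑ t : F, ∏ i, χ (t - c i) ^ e i := by
    rw [Finset.mul_sum]
    refine Finset.sum_congr rfl fun t _ => ?_
    rw [← Finset.prod_mul_distrib]
    refine Finset.prod_congr rfl fun i _ => ?_
    rw [← MulChar.pow_apply' _ (he i), ← map_mul]
    congr 1; ring
  rw [heq, norm_mul, norm_prod, Finset.prod_eq_one, one_mul] at hmain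
  · exact hmain
  · intro i _; exact norm_mulChar_eq _ _ (by simp)

end

section
variable {F : Type} [Field F] [Fintype F]

lemma single_bound (χ : MulChar F ℂ) (n : ℕ) (hn : 0 < n) (hχn : χ ^ n = 1) (hχ1 : χ ≠ 1)
    (hnq : n ∣ Fintype.card F - 1) {ι : Type} [Fintype ι] [DecidableEq ι] (v : ι → F) (e : ι → ℕ)
    (he : ∀ i, e i ≠ 0) (hsum : n ∣ ∑ i, e i) (j0 : ι) (hv : ∀ j, j ≠ j0 → v j ≠ v j0)
    (hcop : (e j0).Coprime n) :
    ‖∑ x : F, ∏ i, χ (x - v i) ^ e i‖ ≤ Fintype.card ι * √(Fintype.card F : ℝ) + 1 := by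
  classical
  let w : {j // j ≠ j0} → F := fun j => - (v j0 - v j)⁻¹
  let e' : {j // j ≠ j0} → ℕ := fun j => e j
  have hsplit : ∀ g : ι → ℕ, ∑ i, g i = g j0 + ∑ j : {j // j ≠ j0}, g j := by
    intro g
    rw [← Finset.sum_subtype (univ.erase j0) (by simp) g, Finset.add_sum_erase _ _ (mem_univ _)]
  have hsplitP : ∀ g : ι → ℂ, ∏ i, g i = g j0 * ∏ j : {j // j ≠ j0}, g j := by
    intro g
    rw [← Finset.prod_subtype (univ.erase j0) (by simp) g, Finset.mul_prod_erase _ _ (mem_univ _)]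
  have hcop' : (∑ j, e' j).Coprime n := by
    have h1 := hsplit e
    obtain ⟨m, hm⟩ := hsum
    rw [hm] at h1
    have h2 : Nat.gcd (∑ j, e' j) n ∣ e j0 := by
      have a1 : Nat.gcd (∑ j, e' j) n ∣ n * m := (Nat.gcd_dvd_right _ _).mul_right m
      rw [h1] at a1
      exact (Nat.dvd_add_left (Nat.gcd_dvd_left _ _)).1 a1
    have h3 := Nat.dvd_gcd h2 (Nat.gcd_dvd_right (∑ j, e' j) n)
    rw [hcop] at h3
    exact Nat.dvd_one.1 h3
  have hw := weil χ n hn hχn hχ1 hnq w e' (fun j => he j) hcop'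
  have hcard : Fintype.card {j // j ≠ j0} + 1 = Fintype.card ι := by
    have h1 := hsplit (fun _ => 1)
    simp only [Finset.sum_const, card_univ, smul_eq_mul, mul_one] at h1
    omega
  rw [hcard] at hw
  set h : F → ℂ := fun t => ∏ j, χ (t - w j) ^ e' j with hh
  set U : ℂ := ∏ j : {j // j ≠ j0}, χ (v j0 - v j) ^ e' j with hU
  have hUn : ‖U‖ = 1 := by
    rw [hU, norm_prod]
    refine Finset.prod_eq_one fun j _ => ?_
    rw [norm_pow, norm_mulChar_eq _ _ (sub_ne_zero.2 (hv j j.2).symm), one_pow]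
  have hterm : ∀ t : F, ∏ i, χ ((v j0 + t⁻¹) - v i) ^ e i = if t = 0 then 0 else U * h t := by
    intro t
    split_ifs with ht
    · rw [hsplitP]
      subst ht
      have h0 : χ (v j0 + (0 : F)⁻¹ - v j0) = 0 := by
        rw [inv_zero, add_zero, sub_self, MulChar.map_zero]
      rw [h0, zero_pow (he j0), zero_mul]
    · have ht' : t⁻¹ ≠ 0 := inv_ne_zero ht
      have h1 : ∀ j : {j // j ≠ j0}, χ ((v j0 + t⁻¹) - v j) ^ e j =
          χ (t⁻¹) ^ e j * (χ (v j0 - v j) ^ e' j * χ (t - w j) ^ e' j) := by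
        intro j
        have ha : v j0 - v j ≠ 0 := sub_ne_zero.2 (hv j j.2).symm
        rw [← mul_pow, ← mul_pow, ← map_mul, ← map_mul]
        congr 2
        simp only [w]
        field_simp
        ring
      rw [hsplitP, Finset.prod_congr rfl fun j _ => h1 j, Finset.prod_mul_distrib,
        Finset.prod_mul_distrib, Finset.prod_pow_eq_pow_sum, add_sub_cancel_left]
      have h2 : χ t⁻¹ ^ e j0 * χ t⁻¹ ^ (∑ j : {j // j ≠ j0}, e j) = 1 := by
        rw [← pow_add, ← hsplit e]
        obtain ⟨m, hm⟩ := hsum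
        rw [hm, pow_mul, pow_val χ n hχn _ ht', one_pow]
      rw [← mul_assoc, h2, one_mul]
  have hre : ∑ x : F, ∏ i, χ (x - v i) ^ e i = U * (∑ t, h t - h 0) := by
    rw [← Equiv.sum_comp ((Equiv.inv F).trans (Equiv.addLeft (v j0)))]
    simp only [Equiv.trans_apply, Equiv.inv_apply, Equiv.coe_addLeft, hterm]
    rw [← Finset.add_sum_erase univ _ (mem_univ (0 : F)), if_pos rfl, zero_add,
      ← Finset.add_sum_erase univ h (mem_univ (0 : F)), add_sub_cancel_left, Finset.mul_sum]
    refine Finset.sum_congr rfl fun t ht => ?_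
    rw [if_neg (Finset.ne_of_mem_erase ht)]
  have hh0 : ‖h 0‖ ≤ 1 := by
    rw [hh, norm_prod]
    refine Finset.prod_le_one (fun _ _ => norm_nonneg _) fun j _ => ?_
    rw [norm_pow]
    exact pow_le_one₀ (norm_nonneg _) (norm_mulChar_le _ _)
  rw [hre, norm_mul, hUn, one_mul]
  exact (norm_sub_le _ _).trans (add_le_add hw hh0)

open Classical in
lemma bad_count (k : ℕ) (hk : 0 < k) (B : Finset F) :
    #{v ∈ Fintype.piFinset (fun _ : Fin k ⊕ Fin k => B) | ∀ j0, ∃ j, j ≠ j0 ∧ v j = v j0} ≤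
      k ^ (2 * k) * #B ^ k := by
  have hsub : {v ∈ Fintype.piFinset (fun _ : Fin k ⊕ Fin k => B) |
      ∀ j0, ∃ j, j ≠ j0 ∧ v j = v j0} ⊆
      ((univ : Finset (Fin k ⊕ Fin k → Fin k)) ×ˢ Fintype.piFinset (fun _ : Fin k => B)).image
        (fun x => x.2 ∘ x.1) := by
    intro v hv
    rw [mem_filter, Fintype.mem_piFinset] at hv
    obtain ⟨hB, hbad⟩ := hv
    have hcard : 2 * #(univ.image v) ≤ 2 * k := by
      have h1 : ∑ y ∈ univ.image v, 2 ≤ ∑ y ∈ univ.image v, #{i | v i = y} := by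
        refine Finset.sum_le_sum fun y hy => ?_
        rw [mem_image] at hy
        obtain ⟨j0, _, rfl⟩ := hy
        obtain ⟨j, hj, hjv⟩ := hbad j0
        rw [← Finset.card_pair hj]
        refine Finset.card_le_card ?_
        intro i hi
        simp only [mem_insert, mem_singleton] at hi
        rw [mem_filter]
        rcases hi with rfl | rfl
        · exact ⟨mem_univ _, hjv⟩
        · exact ⟨mem_univ _, rfl⟩
      rw [← Finset.card_eq_sum_card_image v univ] at h1
      simp only [Finset.sum_const, smul_eq_mul, card_univ, Fintype.card_sum, Fintype.card_fin] at h1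
      omega
    obtain ⟨f⟩ : Nonempty ({y // y ∈ univ.image v} ↪ Fin k) := by
      refine Function.Embedding.nonempty_of_card_le ?_
      rw [Fintype.card_coe, Fintype.card_fin]; omega
    let i0 : Fin k ⊕ Fin k := Sum.inl ⟨0, hk⟩
    haveI : Nonempty {y // y ∈ univ.image v} := ⟨⟨v i0, mem_image_of_mem _ (mem_univ _)⟩⟩
    rw [mem_image]
    refine ⟨(fun i => f ⟨v i, mem_image_of_mem _ (mem_univ _)⟩,
      fun j => ((Function.invFun f j : {y // y ∈ univ.image v}) : F)), ?_, ?_⟩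
    · rw [mem_product, Fintype.mem_piFinset]
      refine ⟨mem_univ _, fun j => ?_⟩
      obtain ⟨i, _, hi⟩ := mem_image.1 (Function.invFun f j).2
      change ((Function.invFun f j : {y // y ∈ univ.image v}) : F) ∈ B
      rw [← hi]
      exact hB i
    · funext i
      simp only [Function.comp]
      rw [Function.leftInverse_invFun f.injective]
  refine (Finset.card_le_card hsub).trans (Finset.card_image_le.trans ?_)
  rw [card_product, Fintype.card_piFinset, card_univ, Fintype.card_fun]
  simp [two_mul]

theorem moment (χ : MulChar F ℂ) (hχ1 : χ ≠ 1) (k : ℕ) (hk : 0 < k) (B : Finset F) :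
    ∑ x : F, ‖∑ b ∈ B, χ (x - b)‖ ^ (2 * k) ≤
      (k : ℝ) ^ (2 * k) * (#B : ℝ) ^ k * Fintype.card F +
        (#B : ℝ) ^ (2 * k) * (2 * k * √(Fintype.card F : ℝ) + 1) := by
  classical
  set q := Fintype.card F with hq
  set n := q - 1 with hn
  have hχn : χ ^ n = 1 := by
    have := MulChar.pow_card_eq_one χ
    rw [Fintype.card_units] at this
    exact this
  have hq1 : 1 < q := Fintype.one_lt_card
  have hn2 : 2 ≤ n := by
    by_contra h
    have h1 : n = 1 := by omega
    rw [h1, pow_one] at hχn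
    exact hχ1 hχn
  have hconj : ∀ x : F, (starRingEnd ℂ) (χ x) = χ x ^ (n - 1) := by
    intro x
    by_cases hx : x = 0
    · subst hx
      rw [MulChar.map_zero, map_zero, zero_pow (by omega)]
    · have h1 : ‖χ x‖ = 1 := norm_mulChar_eq _ _ hx
      have h2 : χ x ^ (n - 1) * χ x = 1 := by
        rw [← pow_succ, Nat.sub_add_cancel (by omega), pow_val χ n hχn x hx]
      have h3 : (starRingEnd ℂ) (χ x) * χ x = 1 := by
        rw [mul_comm, Complex.mul_conj, Complex.normSq_eq_norm_sq, h1]; simp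
      have h4 : χ x ≠ 0 := by intro h; rw [h] at h1; simp at h1
      exact mul_right_cancel₀ h4 (h3.trans h2.symm)
  let e : Fin k ⊕ Fin k → ℕ := Sum.elim (fun _ => 1) (fun _ => n - 1)
  have he : ∀ i, e i ≠ 0 := by
    rintro (i | i)
    · simp [e]
    · simp only [e, Sum.elim_inr]; omega
  have hsum : n ∣ ∑ i, e i := by
    refine ⟨k, ?_⟩
    simp only [e, Fintype.sum_sum_type, Sum.elim_inl, Sum.elim_inr, Finset.sum_const, card_univ,
      Fintype.card_fin, smul_eq_mul]
    obtain ⟨m, hm⟩ : ∃ m, n = m + 1 := ⟨n - 1, by omega⟩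
    rw [hm]; simp; ring
  have hcop : ∀ i, (e i).Coprime n := by
    rintro (i | i)
    · simp [e]
    · simp only [e, Sum.elim_inr]
      obtain ⟨m, hm⟩ : ∃ m, n = m + 1 := ⟨n - 1, by omega⟩
      rw [hm]; simp
  have hexp : ∀ x : F, ((‖∑ b ∈ B, χ (x - b)‖ ^ (2 * k) : ℝ) : ℂ) =
      ∑ v ∈ Fintype.piFinset (fun _ : Fin k ⊕ Fin k => B), ∏ i, χ (x - v i) ^ e i := by
    intro x
    rw [← Finset.prod_univ_sum (fun _ => B) (fun i b => χ (x - b) ^ e i), Fintype.prod_sum_type]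
    simp only [e, Sum.elim_inl, Sum.elim_inr, pow_one, ← hconj, Finset.prod_const, card_univ,
      Fintype.card_fin]
    rw [← map_sum (starRingEnd ℂ), ← mul_pow, Complex.mul_conj, Complex.normSq_eq_norm_sq, pow_mul]
    push_cast
    rfl
  have htot : ((∑ x : F, ‖∑ b ∈ B, χ (x - b)‖ ^ (2 * k) : ℝ) : ℂ) =
      ∑ v ∈ Fintype.piFinset (fun _ : Fin k ⊕ Fin k => B), ∑ x : F, ∏ i, χ (x - v i) ^ e i := by
    rw [Complex.ofReal_sum, Finset.sum_congr rfl fun x _ => hexp x, Finset.sum_comm]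
  have hnn : 0 ≤ ∑ x : F, ‖∑ b ∈ B, χ (x - b)‖ ^ (2 * k) :=
    Finset.sum_nonneg fun _ _ => by positivity
  have hnorm : ∑ x : F, ‖∑ b ∈ B, χ (x - b)‖ ^ (2 * k) =
      ‖∑ v ∈ Fintype.piFinset (fun _ : Fin k ⊕ Fin k => B), ∑ x : F, ∏ i, χ (x - v i) ^ e i‖ := by
    rw [← htot, Complex.norm_real, Real.norm_of_nonneg hnn]
  rw [hnorm]
  refine (norm_sum_le _ _).trans ?_
  rw [← Finset.sum_filter_add_sum_filter_not _ (fun v => ∀ j0, ∃ j, j ≠ j0 ∧ v j = v j0)]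
  refine add_le_add ?_ ?_
  · refine (Finset.sum_le_card_nsmul _ _ (q : ℝ) fun v _ => ?_).trans ?_
    · refine (norm_sum_le _ _).trans ?_
      refine (Finset.sum_le_card_nsmul _ _ 1 fun x _ => ?_).trans ?_
      · rw [norm_prod]
        refine Finset.prod_le_one (fun _ _ => norm_nonneg _) fun j _ => ?_
        rw [norm_pow]
        exact pow_le_one₀ (norm_nonneg _) (norm_mulChar_le _ _)
      · simp [hq]
    · rw [nsmul_eq_mul]
      refine mul_le_mul_of_nonneg_right ?_ (by positivity)
      exact_mod_cast bad_count k hk B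
  · refine (Finset.sum_le_card_nsmul _ _ (2 * k * √(q : ℝ) + 1) fun v hv => ?_).trans ?_
    · rw [mem_filter] at hv
      have hv2 := hv.2
      push Not at hv2
      obtain ⟨j0, hj0⟩ := hv2
      have := single_bound χ n (by omega) hχn hχ1 dvd_rfl v e he hsum j0 hj0 (hcop j0)
      refine this.trans (le_of_eq ?_)
      rw [Fintype.card_sum, Fintype.card_fin]; push_cast; ring
    · rw [nsmul_eq_mul]
      refine mul_le_mul_of_nonneg_right ?_ (by positivity)
      have h1 : #(Fintype.piFinset (fun _ : Fin k ⊕ Fin k => B)) = #B ^ (2 * k) := by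
        rw [Fintype.card_piFinset]; simp [two_mul]
      have h2 := Finset.card_filter_le (Fintype.piFinset (fun _ : Fin k ⊕ Fin k => B))
        (fun v => ¬ ∀ j0, ∃ j, j ≠ j0 ∧ v j = v j0)
      rw [h1] at h2
      exact_mod_cast h2

end

section
variable {F : Type} [Field F] [Fintype F]

lemma moment_arith (s b κ k : ℝ) (hs1 : 1 ≤ s) (hb0 : 0 ≤ b) (hκ : 0 ≤ κ)
    (hsb : s ≤ b) :
    κ * b * (s * s) + b * b * (2 * k * s + 1) ≤ (κ + 2 * k + 1) * (b * b) * s := by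
  have h1 : b * (s * s) ≤ b * b * s := by
    have : 0 ≤ (b * s) * (b - s) := mul_nonneg (mul_nonneg hb0 (by linarith)) (by linarith)
    nlinarith
  have h2 : b * b * (2 * k * s + 1) ≤ b * b * ((2 * k + 1) * s) := by
    refine mul_le_mul_of_nonneg_left ?_ (mul_nonneg hb0 hb0)
    nlinarith
  have h3 := mul_le_mul_of_nonneg_left h1 hκ
  nlinarith

theorem moment_simple (χ : MulChar F ℂ) (hχ1 : χ ≠ 1) (k : ℕ) (hk : 0 < k) (B : Finset F)
    (hB : √(Fintype.card F : ℝ) ≤ (#B : ℝ) ^ k) :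
    ∑ x : F, ‖∑ b ∈ B, χ (x - b)‖ ^ (2 * k) ≤
      ((k : ℝ) ^ (2 * k) + 2 * k + 1) * (#B : ℝ) ^ (2 * k) * √(Fintype.card F : ℝ) := by
  refine (moment χ hχ1 k hk B).trans ?_
  have hq1 : (1 : ℝ) ≤ Fintype.card F := by exact_mod_cast Fintype.card_pos
  have hs1 : 1 ≤ √(Fintype.card F : ℝ) := Real.one_le_sqrt.2 hq1
  have := moment_arith (√(Fintype.card F : ℝ)) ((#B : ℝ) ^ k) ((k : ℝ) ^ (2 * k)) k hs1
    (by positivity) (by positivity) hB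
  rw [Real.mul_self_sqrt (by linarith), ← pow_add, ← two_mul] at this
  exact this

theorem S_bound (ε : ℝ) (hε : 0 < ε) (k : ℕ) (hk : 0 < k) (hkε : 1 / 2 ≤ k * ε)
    (χ : MulChar F ℂ) (hχ1 : χ ≠ 1) (lam : F) (hlam : lam ≠ 0) (A B : Finset F)
    (hA : (Fintype.card F : ℝ) ^ ((1 : ℝ) / 2 + ε) ≤ #A)
    (hB : (Fintype.card F : ℝ) ^ ε ≤ #B) :
    ‖∑ a ∈ A, ∑ b ∈ B, χ (lam - a * b)‖ ≤
      ((k : ℝ) ^ (2 * k) + 2 * k + 2) * (#A * #B * (Fintype.card F : ℝ) ^ (-(ε / (2 * k)))) := by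
  classical
  set q : ℝ := (Fintype.card F : ℝ) with hq
  have hq1 : (1 : ℝ) ≤ q := by rw [hq]; exact_mod_cast Fintype.card_pos
  have hq0 : 0 < q := by linarith
  have hkr : (0 : ℝ) < k := by exact_mod_cast hk
  have hk1 : (1 : ℝ) ≤ k := by exact_mod_cast hk
  set K0 : ℝ := (k : ℝ) ^ (2 * k) + 2 * k + 1 with hK0
  have hK01 : 1 ≤ K0 := by
    have : (0 : ℝ) ≤ (k : ℝ) ^ (2 * k) := by positivity
    linarith
  have hBk : √q ≤ (#B : ℝ) ^ k := by
    have h1 : (q ^ ε) ^ k ≤ (#B : ℝ) ^ k := pow_le_pow_left₀ (by positivity) hB k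
    refine le_trans ?_ h1
    rw [Real.sqrt_eq_rpow, ← Real.rpow_natCast, ← Real.rpow_mul hq0.le]
    exact Real.rpow_le_rpow_of_exponent_le hq1 (by linarith)
  have hmom := moment_simple χ hχ1 k hk B hBk
  have hApos : (0 : ℝ) < #A := lt_of_lt_of_le (by positivity) hA
  set T : ℝ := ∑ a ∈ A.erase 0, ‖∑ b ∈ B, χ (lam / a - b)‖ with hT
  have hT0 : 0 ≤ T := Finset.sum_nonneg fun _ _ => norm_nonneg _
  -- reduction to T
  have hS : ‖∑ a ∈ A, ∑ b ∈ B, χ (lam - a * b)‖ ≤ #B + T := by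
    have h1 : ∀ a ∈ A.erase 0, ‖∑ b ∈ B, χ (lam - a * b)‖ = ‖∑ b ∈ B, χ (lam / a - b)‖ := by
      intro a ha
      have ha0 : a ≠ 0 := Finset.ne_of_mem_erase ha
      have : ∑ b ∈ B, χ (lam - a * b) = χ a * ∑ b ∈ B, χ (lam / a - b) := by
        rw [Finset.mul_sum]
        refine Finset.sum_congr rfl fun b _ => ?_
        rw [← map_mul]; congr 1; field_simp
      rw [this, norm_mul, norm_mulChar_eq _ _ ha0, one_mul]
    have h2 : ‖∑ a ∈ A.erase 0, ∑ b ∈ B, χ (lam - a * b)‖ ≤ T := by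
      refine (norm_sum_le _ _).trans ?_
      rw [hT, Finset.sum_congr rfl h1]
    by_cases h0 : (0 : F) ∈ A
    · rw [← Finset.add_sum_erase A _ h0]
      refine (norm_add_le _ _).trans (add_le_add ?_ h2)
      refine (norm_sum_le _ _).trans ?_
      refine (Finset.sum_le_card_nsmul _ _ 1 fun b _ => norm_mulChar_le _ _).trans ?_
      simp
    · rw [Finset.erase_eq_of_notMem h0] at h2
      have : (0 : ℝ) ≤ #B := by positivity
      linarith
  -- Hoelder
  have hTpow : T ^ (2 * k) ≤ (#A : ℝ) ^ (2 * k - 1) * (K0 * (#B : ℝ) ^ (2 * k) * √q) := by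
    have hsumle : ∑ a ∈ A.erase 0, ‖∑ b ∈ B, χ (lam / a - b)‖ ^ (2 * k) ≤
        ∑ x : F, ‖∑ b ∈ B, χ (x - b)‖ ^ (2 * k) := by
      rw [← Finset.sum_image (s := A.erase 0) (g := fun a => lam / a)
        (f := fun x => ‖∑ b ∈ B, χ (x - b)‖ ^ (2 * k))]
      · exact Finset.sum_le_sum_of_subset_of_nonneg (Finset.subset_univ _)
          fun _ _ _ => by positivity
      · intro a ha a' ha' h
        have ha0 : a ≠ 0 := Finset.ne_of_mem_erase ha
        have ha0' : a' ≠ 0 := Finset.ne_of_mem_erase ha'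
        have h' : lam / a = lam / a' := h
        rw [div_eq_div_iff ha0 ha0'] at h'
        exact (mul_left_cancel₀ hlam h').symm
    have h1 := pow_sum_div_card_le_sum_pow (s := A.erase 0)
      (f := fun a => ‖∑ b ∈ B, χ (lam / a - b)‖) (fun _ _ => norm_nonneg _) (2 * k - 1)
    rw [Nat.sub_add_cancel (by omega), ← hT] at h1
    have h2 := (h1.trans hsumle).trans hmom
    by_cases hA' : #(A.erase 0) = 0
    · have : T = 0 := by
        rw [hT, Finset.card_eq_zero.1 hA', Finset.sum_empty]
      rw [this, zero_pow (by omega)]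
      positivity
    · have hpos : (0 : ℝ) < (#(A.erase 0) : ℝ) ^ (2 * k - 1) := by
        have : (0 : ℝ) < #(A.erase 0) := by exact_mod_cast Nat.pos_of_ne_zero hA'
        positivity
      rw [div_le_iff₀ hpos] at h2
      refine h2.trans ?_
      rw [mul_comm]
      refine mul_le_mul_of_nonneg_right ?_ (by positivity)
      refine pow_le_pow_left₀ (by positivity) ?_ _
      exact_mod_cast Finset.card_erase_le
  have hTle : T ≤ K0 * (#A * #B * q ^ (-(ε / (2 * k)))) := by
    have h0 : 0 ≤ K0 * (#A * #B * q ^ (-(ε / (2 * k)))) := by positivity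
    refine le_of_pow_le_pow_left₀ (n := 2 * k) (by omega) h0 (hTpow.trans ?_)
    have e1 : (q ^ (-(ε / (2 * k)))) ^ (2 * k) = q ^ (-ε) := by
      rw [← Real.rpow_natCast, ← Real.rpow_mul hq0.le]
      congr 1; push_cast; field_simp
    have e2 : √q ≤ #A * q ^ (-ε) := by
      have : q ^ ((1 : ℝ) / 2 + ε) * q ^ (-ε) ≤ #A * q ^ (-ε) :=
        mul_le_mul_of_nonneg_right hA (by positivity)
      rw [← Real.rpow_add hq0] at this
      rw [Real.sqrt_eq_rpow]
      convert this using 2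
      ring
    have e3 : K0 ≤ K0 ^ (2 * k) := le_self_pow₀ hK01 (by omega)
    have e4 : (#A : ℝ) ^ (2 * k) = (#A : ℝ) ^ (2 * k - 1) * #A := by
      rw [← pow_succ, Nat.sub_add_cancel (by omega)]
    rw [mul_pow, mul_pow, mul_pow, e1, e4]
    calc (#A : ℝ) ^ (2 * k - 1) * (K0 * (#B : ℝ) ^ (2 * k) * √q)
        = K0 * ((#A : ℝ) ^ (2 * k - 1) * (#B : ℝ) ^ (2 * k) * √q) := by ring
      _ ≤ K0 ^ (2 * k) * ((#A : ℝ) ^ (2 * k - 1) * (#B : ℝ) ^ (2 * k) * (#A * q ^ (-ε))) := by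
          gcongr
      _ = _ := by ring
  have hBle : (#B : ℝ) ≤ #A * #B * q ^ (-(ε / (2 * k))) := by
    have h1 : 1 ≤ #A * q ^ (-(ε / (2 * k))) := by
      have h2 : q ^ ((1 : ℝ) / 2 + ε) * q ^ (-(ε / (2 * k))) ≤ #A * q ^ (-(ε / (2 * k))) :=
        mul_le_mul_of_nonneg_right hA (by positivity)
      rw [← Real.rpow_add hq0] at h2
      refine le_trans (Real.one_le_rpow hq1 ?_) h2
      have : ε / (2 * k) ≤ ε := div_le_self hε.le (by linarith)
      linarith
    have : (0 : ℝ) ≤ #B := by positivity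
    nlinarith
  calc _ ≤ #B + T := hS
    _ ≤ (#A * #B * q ^ (-(ε / (2 * k)))) + K0 * (#A * #B * q ^ (-(ε / (2 * k)))) :=
        add_le_add hBle hTle
    _ = _ := by rw [hK0]; ring
end

section
variable {F : Type} [Field F] [Fintype F] [DecidableEq F] [Fintype (MulChar F ℂ)]

lemma sum_chars (u : F) (hu : u ≠ 0) :
    ∑ χ : MulChar F ℂ, χ u = if u = 1 then ((Fintype.card F : ℂ) - 1) else 0 := by
  have hF := Fintype.card_pos (α := F)
  split_ifs with h
  · subst h
    have h1 := MulChar.card_eq_card_units_of_hasEnoughRootsOfUnity F ℂ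
    rw [Nat.card_eq_fintype_card, Nat.card_eq_fintype_card, Fintype.card_units] at h1
    simp only [map_one, Finset.sum_const, card_univ, nsmul_eq_mul, mul_one]
    rw [h1, Nat.cast_sub hF, Nat.cast_one]
  · obtain ⟨χ0, h0⟩ := MulChar.exists_apply_ne_one_of_hasEnoughRootsOfUnity F ℂ h
    have h1 : χ0 u * ∑ χ : MulChar F ℂ, χ u = ∑ χ : MulChar F ℂ, χ u := by
      rw [Finset.mul_sum, ← Equiv.sum_comp (Equiv.mulLeft χ0) (fun χ : MulChar F ℂ => χ u)]
      rfl
    have h2 : (χ0 u - 1) * ∑ χ : MulChar F ℂ, χ u = 0 := by linear_combination h1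
    exact (mul_eq_zero.1 h2).resolve_left (sub_ne_zero.2 h0)

lemma ortho (y w : F) :
    ∑ χ : MulChar F ℂ, χ y * (starRingEnd ℂ) (χ w) =
      if y = w ∧ w ≠ 0 then ((Fintype.card F : ℂ) - 1) else 0 := by
  by_cases hw : w = 0
  · simp [hw, MulChar.map_zero]
  by_cases hy : y = 0
  · subst hy
    rw [if_neg (by rintro ⟨rfl, h⟩; exact h rfl)]
    simp [MulChar.map_zero]
  have h1 : ∀ χ : MulChar F ℂ, χ y * (starRingEnd ℂ) (χ w) = χ (y / w) := by
    intro χ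
    have hn : ‖χ w‖ = 1 := norm_mulChar_eq _ _ hw
    have h3 : χ w * (starRingEnd ℂ) (χ w) = 1 := by
      rw [Complex.mul_conj, Complex.normSq_eq_norm_sq, hn]; simp
    have h4 : χ y = χ (y / w) * χ w := by rw [← map_mul, div_mul_cancel₀ _ hw]
    rw [h4, mul_assoc, h3, mul_one]
  rw [Finset.sum_congr rfl fun χ _ => h1 χ, sum_chars _ (div_ne_zero hy hw)]
  simp only [div_eq_one_iff_eq hw, hw, ne_eq, not_false_eq_true, and_true]

lemma parseval (C : Finset F) :
    ∑ χ : MulChar F ℂ, ‖∑ c ∈ C, χ c‖ ^ 2 ≤ ((Fintype.card F : ℝ) - 1) * #C := by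
  have h1 : ((∑ χ : MulChar F ℂ, ‖∑ c ∈ C, χ c‖ ^ 2 : ℝ) : ℂ) =
      (((Fintype.card F : ℝ) - 1) * #(C.erase 0) : ℝ) := by
    have : ∀ χ : MulChar F ℂ, ((‖∑ c ∈ C, χ c‖ ^ 2 : ℝ) : ℂ) =
        ∑ c ∈ C, ∑ c' ∈ C, χ c * (starRingEnd ℂ) (χ c') := by
      intro χ
      rw [← Complex.normSq_eq_norm_sq, ← Complex.mul_conj, map_sum, Finset.sum_mul_sum]
    rw [Complex.ofReal_sum, Finset.sum_congr rfl fun χ _ => this χ, Finset.sum_comm]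
    have h2 : ∀ c ∈ C, ∑ χ : MulChar F ℂ, ∑ c' ∈ C, χ c * (starRingEnd ℂ) (χ c') =
        if c ≠ 0 then ((Fintype.card F : ℂ) - 1) else 0 := by
      intro c hc
      rw [Finset.sum_comm, Finset.sum_congr rfl fun c' _ => ortho c c']
      by_cases h0 : c = 0
      · rw [if_neg (by simp [h0])]
        refine Finset.sum_eq_zero fun c' _ => ?_
        rw [if_neg]
        rintro ⟨rfl, h⟩; exact h h0
      · rw [if_pos h0, Finset.sum_eq_single_of_mem c hc, if_pos ⟨rfl, h0⟩]
        intro b _ hb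
        rw [if_neg]
        rintro ⟨rfl, _⟩; exact hb rfl
    rw [Finset.sum_congr rfl h2, ← Finset.sum_filter, Finset.sum_const, nsmul_eq_mul,
      Finset.filter_ne' C 0]
    push_cast; ring
  have h2 := Complex.ofReal_injective h1
  rw [h2]
  have hq : (1 : ℝ) ≤ Fintype.card F := by exact_mod_cast Fintype.card_pos
  refine mul_le_mul_of_nonneg_left ?_ (by linarith)
  exact_mod_cast Finset.card_erase_le

lemma count_bound (lam : F) (A B C D : Finset F) (W : ℝ) (hW0 : 0 ≤ W)
    (hW : ∀ χ : MulChar F ℂ, χ ≠ 1 → ‖∑ a ∈ A, ∑ b ∈ B, χ (lam - a * b)‖ ≤ W) :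
    |(#{x ∈ A ×ˢ B ×ˢ C ×ˢ D | lam - x.1 * x.2.1 = x.2.2.1 * x.2.2.2 ∧ x.2.2.1 * x.2.2.2 ≠ 0} : ℝ) -
      #{x ∈ A ×ˢ B | lam - x.1 * x.2 ≠ 0} * #(C.erase 0) * #(D.erase 0) /
        ((Fintype.card F : ℝ) - 1)| ≤ W * √(#C * #D) := by
  have hq : (1 : ℝ) < Fintype.card F := by exact_mod_cast Fintype.one_lt_card
  have hq' : (0 : ℝ) < (Fintype.card F : ℝ) - 1 := by linarith
  set N := #{x ∈ A ×ˢ B ×ˢ C ×ˢ D | lam - x.1 * x.2.1 = x.2.2.1 * x.2.2.2 ∧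
    x.2.2.1 * x.2.2.2 ≠ 0} with hN
  set S : MulChar F ℂ → ℂ := fun χ => ∑ a ∈ A, ∑ b ∈ B, χ (lam - a * b) with hS
  set G : Finset F → MulChar F ℂ → ℂ := fun C χ => ∑ c ∈ C, χ c with hG
  have hkey : ((Fintype.card F : ℂ) - 1) * N =
      ∑ χ : MulChar F ℂ, S χ * (starRingEnd ℂ) (G C χ * G D χ) := by
    have h1 : ∀ χ : MulChar F ℂ, S χ * (starRingEnd ℂ) (G C χ * G D χ) =
        ∑ x ∈ A ×ˢ B ×ˢ C ×ˢ D,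
          χ (lam - x.1 * x.2.1) * (starRingEnd ℂ) (χ (x.2.2.1 * x.2.2.2)) := by
      intro χ
      simp only [hS, hG, Finset.sum_product, map_mul, map_sum]
      rw [Finset.sum_mul_sum (s := C), Finset.sum_mul]
      refine Finset.sum_congr rfl fun a _ => ?_
      rw [Finset.sum_mul]
      refine Finset.sum_congr rfl fun b _ => ?_
      rw [Finset.mul_sum]
      refine Finset.sum_congr rfl fun c _ => ?_
      rw [Finset.mul_sum]
    rw [Finset.sum_congr rfl fun χ _ => h1 χ, Finset.sum_comm,
      Finset.sum_congr rfl fun x _ => ortho (lam - x.1 * x.2.1) (x.2.2.1 * x.2.2.2),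
      ← Finset.sum_filter, Finset.sum_const, nsmul_eq_mul, mul_comm]
  have hone : ∀ x : F, (1 : MulChar F ℂ) x = if x ≠ 0 then 1 else 0 := by
    intro x
    split_ifs with h
    · exact MulChar.one_apply (isUnit_iff_ne_zero.2 h)
    · rw [not_not] at h; rw [h, MulChar.map_zero]
  have hS1 : S 1 = #{x ∈ A ×ˢ B | lam - x.1 * x.2 ≠ 0} := by
    simp only [hS, hone]
    rw [← Finset.sum_product' (f := fun a b => if lam - a * b ≠ 0 then (1 : ℂ) else 0),
      ← Finset.sum_filter, Finset.sum_const, nsmul_eq_mul, mul_one]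
  have hG1 : ∀ C, G C 1 = #(C.erase 0) := by
    intro C
    simp only [hG, hone]
    rw [← Finset.sum_filter, Finset.sum_const, nsmul_eq_mul, mul_one, Finset.filter_ne']
  classical
  rw [← Finset.add_sum_erase univ _ (mem_univ (1 : MulChar F ℂ)), hS1, hG1, hG1] at hkey
  set R : ℂ := ∑ χ ∈ univ.erase (1 : MulChar F ℂ), S χ * (starRingEnd ℂ) (G C χ * G D χ) with hR
  have hRle : ‖R‖ ≤ W * (((Fintype.card F : ℝ) - 1) * √(#C * #D)) := by
    have h1 : ‖R‖ ≤ ∑ χ ∈ univ.erase (1 : MulChar F ℂ), W * (‖G C χ‖ * ‖G D χ‖) := by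
      refine (norm_sum_le _ _).trans (Finset.sum_le_sum fun χ hχ => ?_)
      rw [norm_mul, RCLike.norm_conj, norm_mul]
      exact mul_le_mul_of_nonneg_right (hW χ (Finset.ne_of_mem_erase hχ)) (by positivity)
    have h2 : ∑ χ ∈ univ.erase (1 : MulChar F ℂ), W * (‖G C χ‖ * ‖G D χ‖) ≤
        ∑ χ : MulChar F ℂ, W * (‖G C χ‖ * ‖G D χ‖) :=
      Finset.sum_le_sum_of_subset_of_nonneg (Finset.subset_univ _) fun _ _ _ => by positivity
    have h2' := h1.trans h2
    rw [← Finset.mul_sum] at h2'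
    refine h2'.trans (mul_le_mul_of_nonneg_left ?_ hW0)
    have h3 := Finset.sum_mul_sq_le_sq_mul_sq univ (fun χ : MulChar F ℂ => ‖G C χ‖)
      (fun χ => ‖G D χ‖)
    have h4 : (∑ χ : MulChar F ℂ, ‖G C χ‖ ^ 2) * (∑ χ : MulChar F ℂ, ‖G D χ‖ ^ 2) ≤
        (((Fintype.card F : ℝ) - 1) * #C) * (((Fintype.card F : ℝ) - 1) * #D) := by
      refine mul_le_mul (parseval C) (parseval D) ?_ (by positivity)
      exact Finset.sum_nonneg fun _ _ => by positivity
    refine (Real.le_sqrt_of_sq_le (h3.trans h4)).trans (le_of_eq ?_)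
    rw [show (((Fintype.card F : ℝ) - 1) * #C) * (((Fintype.card F : ℝ) - 1) * #D) =
      ((Fintype.card F : ℝ) - 1) ^ 2 * (#C * #D) by ring, Real.sqrt_mul (by positivity),
      Real.sqrt_sq hq'.le]
  have hfin : R = ((((Fintype.card F : ℝ) - 1) * ((N : ℝ) -
      #{x ∈ A ×ˢ B | lam - x.1 * x.2 ≠ 0} * #(C.erase 0) * #(D.erase 0) /
        ((Fintype.card F : ℝ) - 1)) : ℝ) : ℂ) := by
    have e : ((Fintype.card F : ℝ) - 1) * ((N : ℝ) -
      #{x ∈ A ×ˢ B | lam - x.1 * x.2 ≠ 0} * #(C.erase 0) * #(D.erase 0) /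
        ((Fintype.card F : ℝ) - 1)) = ((Fintype.card F : ℝ) - 1) * (N : ℝ) -
      #{x ∈ A ×ˢ B | lam - x.1 * x.2 ≠ 0} * #(C.erase 0) * #(D.erase 0) := by
      field_simp
    rw [e]
    push_cast
    rw [hkey, map_mul, Complex.conj_natCast, Complex.conj_natCast]
    ring
  rw [hfin, Complex.norm_real, norm_mul, Real.norm_of_nonneg hq'.le, Real.norm_eq_abs] at hRle
  refine le_of_mul_le_mul_left (hRle.trans (le_of_eq ?_)) hq'
  ring

end

section
variable {F : Type} [Field F] [Fintype F] [DecidableEq F]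

lemma zero_pairs (lam : F) (hlam : lam ≠ 0) (A B : Finset F) :
    #{x ∈ A ×ˢ B | lam - x.1 * x.2 = 0} ≤ #B := by
  refine Finset.card_le_card_of_injOn (fun x => x.2) ?_ ?_
  · intro x hx
    have := (mem_filter.1 hx).1
    exact (mem_product.1 this).2
  · intro x hx y hy hxy
    have hx' := (mem_filter.1 hx).2
    have hy' := (mem_filter.1 hy).2
    have hxy' : x.2 = y.2 := hxy
    have h1 : x.1 * x.2 = lam := (sub_eq_zero.1 hx').symm
    have h2 : y.1 * y.2 = lam := (sub_eq_zero.1 hy').symm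
    have h0 : x.2 ≠ 0 := by intro h; rw [h, mul_zero] at h1; exact hlam h1.symm
    rw [← hxy', ← h1] at h2
    exact Prod.ext (mul_right_cancel₀ h0 h2).symm hxy'

lemma nonzero_pairs (lam : F) (hlam : lam ≠ 0) (A B : Finset F) :
    (#A : ℝ) * #B - #B ≤ #{x ∈ A ×ˢ B | lam - x.1 * x.2 ≠ 0} ∧
      (#{x ∈ A ×ˢ B | lam - x.1 * x.2 ≠ 0} : ℝ) ≤ #A * #B := by
  have h1 := Finset.card_filter_add_card_filter_not (s := A ×ˢ B) (fun x => lam - x.1 * x.2 = 0)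
  have h2 := zero_pairs lam hlam A B
  rw [card_product] at h1
  have h1' : (#{x ∈ A ×ˢ B | lam - x.1 * x.2 = 0} : ℝ) + #{x ∈ A ×ˢ B | lam - x.1 * x.2 ≠ 0} =
    #A * #B := by exact_mod_cast h1
  have h2' : (#{x ∈ A ×ˢ B | lam - x.1 * x.2 = 0} : ℝ) ≤ #B := by exact_mod_cast h2
  constructor
  · linarith
  · have : (0 : ℝ) ≤ #{x ∈ A ×ˢ B | lam - x.1 * x.2 = 0} := by positivity
    linarith

lemma prod_zero_pairs (C D : Finset F) : #{x ∈ C ×ˢ D | x.1 * x.2 = 0} ≤ #C + #D := by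
  have hsub : {x ∈ C ×ˢ D | x.1 * x.2 = 0} ⊆ (C ×ˢ {0}) ∪ ({0} ×ˢ D) := by
    rintro ⟨c, d⟩ h
    simp only [mem_filter, mem_product] at h
    simp only [mem_union, mem_product, mem_singleton]
    rcases mul_eq_zero.1 h.2 with h' | h'
    · exact Or.inr ⟨h', h.1.2⟩
    · exact Or.inl ⟨h.1.1, h'⟩
  refine (Finset.card_le_card hsub).trans ((Finset.card_union_le _ _).trans ?_)
  simp

lemma split_count (lam : F) (hlam : lam ≠ 0) (A B C D : Finset F) :
    ∃ N0 : ℝ, 0 ≤ N0 ∧ N0 ≤ #B * (#C + #D) ∧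
    (#{x ∈ A ×ˢ B ×ˢ C ×ˢ D | x.1 * x.2.1 + x.2.2.1 * x.2.2.2 = lam} : ℝ) = N0 +
      #{x ∈ A ×ˢ B ×ˢ C ×ˢ D | lam - x.1 * x.2.1 = x.2.2.1 * x.2.2.2 ∧
        x.2.2.1 * x.2.2.2 ≠ 0} := by
  set T := {x ∈ A ×ˢ B ×ˢ C ×ˢ D | x.1 * x.2.1 + x.2.2.1 * x.2.2.2 = lam} with hT
  have h1 := Finset.card_filter_add_card_filter_not (s := T) (fun x => x.2.2.1 * x.2.2.2 = 0)
  refine ⟨#{x ∈ T | x.2.2.1 * x.2.2.2 = 0}, by positivity, ?_, ?_⟩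
  · have h2 : #{x ∈ T | x.2.2.1 * x.2.2.2 = 0} ≤
        #({x ∈ A ×ˢ B | lam - x.1 * x.2 = 0} ×ˢ {x ∈ C ×ˢ D | x.1 * x.2 = 0}) := by
      refine Finset.card_le_card_of_injOn (fun x => ((x.1, x.2.1), (x.2.2.1, x.2.2.2))) ?_ ?_
      · rintro ⟨a, b, c, d⟩ hx
        simp only [hT, Finset.coe_filter, mem_filter, mem_product, Set.mem_setOf_eq] at hx
        simp only [Finset.coe_product, Finset.coe_filter, Set.mem_prod, Set.mem_setOf_eq, mem_product]
        obtain ⟨⟨⟨ha, hb, hc, hd⟩, h⟩, h0⟩ := hx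
        rw [h0, add_zero] at h
        exact ⟨⟨⟨ha, hb⟩, by rw [h, sub_self]⟩, ⟨hc, hd⟩, h0⟩
      · rintro ⟨a, b, c, d⟩ _ ⟨a', b', c', d'⟩ _ h
        simp only [Prod.mk.injEq] at h ⊢
        tauto
    rw [card_product] at h2
    have h3 := h2.trans (Nat.mul_le_mul (zero_pairs lam hlam A B) (prod_zero_pairs C D))
    exact_mod_cast h3
  · have h2 : {x ∈ A ×ˢ B ×ˢ C ×ˢ D | lam - x.1 * x.2.1 = x.2.2.1 * x.2.2.2 ∧
        x.2.2.1 * x.2.2.2 ≠ 0} = {x ∈ T | ¬ x.2.2.1 * x.2.2.2 = 0} := by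
      rw [hT, Finset.filter_filter]
      refine Finset.filter_congr fun x _ => ?_
      rw [sub_eq_iff_eq_add, eq_comm, add_comm]
    rw [h2]
    exact_mod_cast h1.symm

end

lemma final_arith (q a b c d N N0 N1 X c' d' W s t K1 : ℝ) (hq : 2 ≤ q) (ha : 1 ≤ a) (hb : 0 ≤ b)
    (hc : 1 ≤ c) (hd : 1 ≤ d) (hN : N = N0 + N1) (hN0 : 0 ≤ N0) (hN0' : N0 ≤ b * (c + d))
    (hX : a * b - b ≤ X) (hX' : X ≤ a * b) (hc1 : c - 1 ≤ c') (hc2 : c' ≤ c)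
    (hd1 : d - 1 ≤ d') (hd2 : d' ≤ d)
    (h1 : |N1 - X * c' * d' / (q - 1)| ≤ W * s) (hK1 : 0 ≤ K1)
    (hW : W * s ≤ K1 * (t * (a * b * c * d / q)))
    (ht0 : 0 ≤ t) (hta : 1 / a ≤ t) (htc : 1 / c ≤ t) (htd : 1 / d ≤ t) (htq : 1 / q ≤ t)
    (htac : q / (a * c) ≤ t) (htad : q / (a * d) ≤ t) :
    |N - a * b * c * d / q| ≤ (K1 + 7) * t * (a * b * c * d / q) := by
  set m := a * b * c * d / q with hm
  have hq0 : 0 < q := by linarith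
  have hm0 : 0 ≤ m := by positivity
  have hX0 : 0 ≤ X := by nlinarith
  have hP1 : X * c' * d' / (q - 1) ≤ m + 2 * t * m := by
    have e1 : X * c' * d' ≤ a * b * c * d := by
      have : X * c' ≤ a * b * c := mul_le_mul hX' hc2 (by linarith) (by positivity)
      exact mul_le_mul this hd2 (by linarith) (by positivity)
    have e2 : X * c' * d' / (q - 1) ≤ a * b * c * d / (q - 1) :=
      div_le_div_of_nonneg_right e1 (by linarith)
    have e3 : a * b * c * d / (q - 1) ≤ m + 2 * (1 / q) * m := by
      rw [div_le_iff₀ (by linarith)]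
      have : a * b * c * d = m * q := by rw [hm]; field_simp
      rw [this]
      have h5 : (m + 2 * (1 / q) * m) * (q - 1) - m * q = m * (1 - 2 / q) := by field_simp; ring
      have h6 : 2 / q ≤ 1 := by rw [div_le_one hq0]; exact hq
      have h7 : 0 ≤ m * (1 - 2 / q) := mul_nonneg hm0 (by linarith)
      linarith
    have e4 : 2 * (1 / q) * m ≤ 2 * t * m := by gcongr
    linarith
  have hP2 : m - 3 * t * m ≤ X * c' * d' / (q - 1) := by
    have e1 : (a * b - b) * (c - 1) * (d - 1) ≤ X * c' * d' := by
      have h0 : 0 ≤ a * b - b := by nlinarith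
      have : (a * b - b) * (c - 1) ≤ X * c' := mul_le_mul hX hc1 (by linarith) hX0
      exact mul_le_mul this hd1 (by linarith) (mul_nonneg hX0 (by linarith))
    have e0 : 0 ≤ X * c' * d' := mul_nonneg (mul_nonneg hX0 (by linarith)) (by linarith)
    have e2 : X * c' * d' / q ≤ X * c' * d' / (q - 1) :=
      div_le_div_of_nonneg_left e0 (by linarith) (by linarith)
    have e3 : (a * b - b) * (c - 1) * (d - 1) / q ≤ X * c' * d' / q :=
      div_le_div_of_nonneg_right e1 hq0.le
    have e4 : (a * b - b) * (c - 1) * (d - 1) / q = m * ((1 - 1 / a) * (1 - 1 / c) * (1 - 1 / d)) := by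
      rw [hm]; field_simp
    have u1 : 0 ≤ 1 / a := by positivity
    have u2 : 0 ≤ 1 / c := by positivity
    have u3 : 0 ≤ 1 / d := by positivity
    have v1 : 1 / a ≤ 1 := by rw [div_le_one (by linarith)]; exact ha
    have v2 : 1 / c ≤ 1 := by rw [div_le_one (by linarith)]; exact hc
    have v3 : 1 / d ≤ 1 := by rw [div_le_one (by linarith)]; exact hd
    have e5 : 1 - 3 * t ≤ (1 - 1 / a) * (1 - 1 / c) * (1 - 1 / d) := by
      have w1 : 1 - 1 / a - 1 / c ≤ (1 - 1 / a) * (1 - 1 / c) := by nlinarith [mul_nonneg u1 u2]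
      have w2 : (1 - 1 / a) * (1 - 1 / c) ≤ 1 := by
        refine mul_le_one₀ (by linarith) (by linarith) (by linarith)
      have w3 : (1 - 1 / a) * (1 - 1 / c) - 1 / d ≤ (1 - 1 / a) * (1 - 1 / c) * (1 - 1 / d) := by
        nlinarith
      linarith
    have e6 := mul_le_mul_of_nonneg_left e5 hm0
    have e7 : m * (1 - 3 * t) = m - 3 * t * m := by ring
    rw [e7, ← e4] at e6
    exact (e6.trans e3).trans e2
  have hN0t : N0 ≤ 2 * t * m := by
    have e1 : b * (c + d) = (q / (a * c) + q / (a * d)) * m := by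
      rw [hm]; field_simp; ring
    have : (q / (a * c) + q / (a * d)) * m ≤ (2 * t) * m :=
      mul_le_mul_of_nonneg_right (by linarith) hm0
    linarith
  have h1' := abs_le.1 (h1.trans hW)
  have htm : 0 ≤ t * m := mul_nonneg ht0 hm0
  rw [abs_le]
  obtain ⟨g1, g2⟩ := h1'
  have e8 : (K1 + 7) * t * m = K1 * (t * m) + 7 * (t * m) := by ring
  have e9 : 2 * t * m = 2 * (t * m) := by ring
  have e10 : 3 * t * m = 3 * (t * m) := by ring
  rw [e8, hN]
  rw [e9] at hN0t hP1
  rw [e10] at hP2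
  clear_value m
  constructor
  · linarith
  · linarith

end KWeil

/-- Theorem 1 (first part): for every `ε > 0` there exists `δ > 0` such that for all
sufficiently large finite fields `F` with `q` elements, every nonzero `λ`, and all sets
`A, B, C, D ⊆ F` with `|A| ≥ q^{1/2+ε}`, `|B| ≥ q^ε` and `|C||D| ≥ q^{2-δ}`, the number
`N` of solutions of `ab + cd = λ` in `A×B×C×D` satisfies
`N = (|A||B||C||D|/q)(1 + O(q^{-δ}))`. -/
theorem asymptotic_ab_cd (ε : ℝ) (hε : 0 < ε) :
    ∃ δ : ℝ, 0 < δ ∧ ∃ K : ℝ, 0 < K ∧ ∃ Q : ℕ,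
      ∀ (F : Type) [Field F] [Fintype F] [DecidableEq F],
        Q ≤ Fintype.card F →
        ∀ (lam : F), lam ≠ 0 →
        ∀ (A B C D : Finset F),
          (A.card : ℝ) ≥ (Fintype.card F : ℝ) ^ ((1 : ℝ) / 2 + ε) →
          (B.card : ℝ) ≥ (Fintype.card F : ℝ) ^ (ε : ℝ) →
          (C.card * D.card : ℝ) ≥ (Fintype.card F : ℝ) ^ ((2 : ℝ) - δ) →
          abs ((((A ×ˢ B ×ˢ C ×ˢ D).filter
              (fun x => x.1 * x.2.1 + x.2.2.1 * x.2.2.2 = lam)).card : ℝ) -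
            (A.card * B.card * C.card * D.card : ℝ) / (Fintype.card F : ℝ)) ≤
          K * (Fintype.card F : ℝ) ^ (-δ) *
            ((A.card * B.card * C.card * D.card : ℝ) / (Fintype.card F : ℝ)) := by
  obtain ⟨k0, hk0⟩ := exists_nat_ge (1 / (2 * ε))
  set k := k0 + 1 with hk
  have hkpos : 0 < k := by omega
  have hkr : (1 : ℝ) ≤ k := by exact_mod_cast hkpos
  have hkε : 1 / 2 ≤ (k : ℝ) * ε := by
    have h1 : 1 / (2 * ε) ≤ (k : ℝ) := by rw [hk]; push_cast; linarith
    rw [div_le_iff₀ (by positivity)] at h1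
    linarith
  set η : ℝ := ε / (2 * k) with hη
  have hη0 : 0 < η := by positivity
  set δ : ℝ := min (η / 2) (1 / 8) with hδ
  have hδ0 : 0 < δ := lt_min (by positivity) (by norm_num)
  have hδ1 : δ ≤ η / 2 := min_le_left _ _
  have hδ2 : δ ≤ 1 / 8 := min_le_right _ _
  set K1 : ℝ := (k : ℝ) ^ (2 * k) + 2 * k + 2 with hK1
  have hK10 : 0 ≤ K1 := by positivity
  refine ⟨δ, hδ0, K1 + 7, by positivity, 2, ?_⟩
  intro F _ _ _ hQ lam hlam A B C D hA hB hCD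
  letI : Fintype (MulChar F ℂ) := Fintype.ofFinite _
  have hq2 : (2 : ℝ) ≤ Fintype.card F := by exact_mod_cast hQ
  have hCq : (#C : ℝ) ≤ Fintype.card F := by exact_mod_cast Finset.card_le_univ C
  have hDq : (#D : ℝ) ≤ Fintype.card F := by exact_mod_cast Finset.card_le_univ D
  have hqdef : ∃ q : ℝ, q = (Fintype.card F : ℝ) := ⟨_, rfl⟩
  obtain ⟨q, hq⟩ := hqdef
  set W : ℝ := K1 * (#A * #B * q ^ (-η)) with hW
  have hq00 : (0 : ℝ) ≤ q := by rw [hq]; positivity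
  have hW0 : 0 ≤ W := by
    rw [hW]
    exact mul_nonneg hK10 (mul_nonneg (by positivity) (Real.rpow_nonneg hq00 _))
  have hcount := KWeil.count_bound lam A B C D W hW0 (by
    intro χ hχ
    rw [hW, hq]
    exact KWeil.S_bound ε hε k hkpos hkε χ hχ lam hlam A B hA hB)
  obtain ⟨N0, hN0, hN0', hN⟩ := KWeil.split_count lam hlam A B C D
  obtain ⟨hX, hX'⟩ := KWeil.nonzero_pairs lam hlam A B
  have her : ∀ S : Finset F, (#S : ℝ) - 1 ≤ #(S.erase 0) ∧ (#(S.erase 0) : ℝ) ≤ #S := by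
    intro S
    constructor
    · have h1 := Finset.pred_card_le_card_erase (s := S) (a := (0 : F))
      have h2 : #S ≤ #(S.erase 0) + 1 := by omega
      have h3 : (#S : ℝ) ≤ #(S.erase 0) + 1 := by exact_mod_cast h2
      linarith
    · exact_mod_cast Finset.card_erase_le
  rw [← hq] at hA hB hCD hq2 hCq hDq hcount ⊢
  have hq0 : 0 < q := by linarith
  have hq1 : 1 ≤ q := by linarith
  have hA1 : (1 : ℝ) ≤ #A := le_trans (Real.one_le_rpow hq1 (by linarith)) hA
  have hsplit : q ^ ((2 : ℝ) - δ) = q ^ ((1 : ℝ) - δ) * q := by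
    rw [← Real.rpow_add_one hq0.ne']; congr 1; ring
  have hC1 : q ^ ((1 : ℝ) - δ) ≤ #C := by
    have : q ^ ((1 : ℝ) - δ) * q ≤ #C * q := by
      rw [← hsplit]
      exact hCD.le.trans (mul_le_mul_of_nonneg_left hDq (by positivity))
    exact le_of_mul_le_mul_right this hq0
  have hD1 : q ^ ((1 : ℝ) - δ) ≤ #D := by
    have : q ^ ((1 : ℝ) - δ) * q ≤ #D * q := by
      rw [← hsplit]
      refine hCD.le.trans ?_
      rw [mul_comm]
      exact mul_le_mul_of_nonneg_left hCq (by positivity)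
    exact le_of_mul_le_mul_right this hq0
  have hone : (1 : ℝ) ≤ q ^ ((1 : ℝ) - δ) := Real.one_le_rpow hq1 (by linarith)
  have hC1' : (1 : ℝ) ≤ #C := hone.trans hC1
  have hD1' : (1 : ℝ) ≤ #D := hone.trans hD1
  -- generic reciprocal bound
  have hrec : ∀ (x y : ℝ), q ^ x ≤ y → δ ≤ x → 1 / y ≤ q ^ (-δ) := by
    intro x y hxy hx
    have h1 : q ^ δ ≤ y := (Real.rpow_le_rpow_of_exponent_le hq1 hx).trans hxy
    rw [Real.rpow_neg hq0.le, ← one_div]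
    exact one_div_le_one_div_of_le (by positivity) h1
  have hAC : ∀ y : ℝ, q ^ ((1 : ℝ) - δ) ≤ y → q / (#A * y) ≤ q ^ (-δ) := by
    intro y hy
    have hy0 : 0 < y := lt_of_lt_of_le (by linarith) hy
    have h1 : q ^ ((1 : ℝ) / 2 + ε) * q ^ ((1 : ℝ) - δ) ≤ #A * y :=
      mul_le_mul hA hy (by positivity) (by positivity)
    rw [div_le_iff₀ (by positivity)]
    refine le_trans ?_ (mul_le_mul_of_nonneg_left h1 (by positivity))
    rw [← Real.rpow_add hq0, ← Real.rpow_add hq0]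
    conv_lhs => rw [← Real.rpow_one q]
    exact Real.rpow_le_rpow_of_exponent_le hq1 (by linarith)
  refine KWeil.final_arith q #A #B #C #D _ N0 _ _ _ _ W (√(#C * #D)) (q ^ (-δ)) K1 hq2 hA1
    (by positivity) hC1' hD1' hN hN0 hN0' hX hX' (her C).1 (her C).2 (her D).1 (her D).2 hcount hK10
    ?_ (by positivity) (hrec _ _ hA (by linarith)) (hrec _ _ hC1 (by linarith))
    (hrec _ _ hD1 (by linarith)) (hrec 1 q (by rw [Real.rpow_one]) (by linarith))
    (hAC _ hC1) (hAC _ hD1)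
  -- the error term
  have hs0 : 0 < √((#C : ℝ) * #D) := Real.sqrt_pos.2 (by positivity)
  have hs : q ^ ((1 : ℝ) - δ / 2) ≤ √((#C : ℝ) * #D) := by
    refine Real.le_sqrt_of_sq_le ?_
    rw [← Real.rpow_natCast, ← Real.rpow_mul hq0.le]
    refine le_trans (le_of_eq ?_) hCD.le
    congr 1; push_cast; ring
  have hss : √((#C : ℝ) * #D) * √((#C : ℝ) * #D) = (#C : ℝ) * #D :=
    Real.mul_self_sqrt (by positivity)
  have hkey : q ^ (-η) * q ≤ q ^ (-δ) * √((#C : ℝ) * #D) := by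
    refine le_trans ?_ (mul_le_mul_of_nonneg_left hs (by positivity))
    rw [← Real.rpow_add_one hq0.ne', ← Real.rpow_add hq0]
    exact Real.rpow_le_rpow_of_exponent_le hq1 (by linarith)
  have hkey2 : q ^ (-η) ≤ q ^ (-δ) * √((#C : ℝ) * #D) / q := by
    rw [le_div_iff₀ hq0]; exact hkey
  calc W * √((#C : ℝ) * #D) = K1 * (#A * #B * √((#C : ℝ) * #D)) * q ^ (-η) := by rw [hW]; ring
    _ ≤ K1 * (#A * #B * √((#C : ℝ) * #D)) * (q ^ (-δ) * √((#C : ℝ) * #D) / q) :=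
        mul_le_mul_of_nonneg_left hkey2
          (mul_nonneg hK10 (mul_nonneg (mul_nonneg (Nat.cast_nonneg _) (Nat.cast_nonneg _)) hs0.le))
    _ = K1 * (q ^ (-δ) * (#A * #B * (√((#C : ℝ) * #D) * √((#C : ℝ) * #D)) / q)) := by ring
    _ = _ := by rw [hss]; ring
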